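/- arXiv:2003.12335 — 6 statements merged into one kernel-verified Lean document; each statement's English description precedes it below -/
import Mathlib

section
/- Let Ω and Y be proper subdomains of ℂ. Suppose that for every b ∈ Ω there exist a point a ∈ Y and a holomorphic covering map h_b from Y∖{a} onto Ω∖{b} that extends to a holomorphic map of Y onto Ω with h_b(a) = b and h_b'(a) ≠ 0. Then η_Ω^Y(w) = η_Ω(w) for all w ∈ Ω. -/
open Complex Set Metric
open scoped ENNReal

noncomputable section

/-- The open unit disk in the complex plane. -/
def unitDisk : Set ℂ := Metric.ball (0 : ℂ) 1

/-- A plane domain: a nonempty open connected subset of ℂ. -/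
def IsPlaneDomain (S : Set ℂ) : Prop := IsOpen S ∧ IsConnected S

/-- The Hurwitz radius `r_Ω(w)`: the supremum of `h'(0)` over all holomorphic
`h : 𝔻 → Ω` with `h 0 = w`, `h t ≠ w` for `t ∈ 𝔻 \ {0}`, and `h'(0) > 0` (real). -/
def hurwitzRadius (Ω : Set ℂ) (w : ℂ) : ℝ :=
  sSup { r : ℝ | 0 < r ∧ ∃ h : ℂ → ℂ, DifferentiableOn ℂ h unitDisk ∧
    Set.MapsTo h unitDisk Ω ∧ h 0 = w ∧ (∀ t ∈ unitDisk, t ≠ 0 → h t ≠ w) ∧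
    deriv h 0 = (r : ℂ) }

/-- The Hurwitz density `η_Ω(w) = 2 / r_Ω(w)`. -/
def hurwitzDensity (Ω : Set ℂ) (w : ℂ) : ℝ := 2 / hurwitzRadius Ω w

/-- A (C¹, hence rectifiable) path in `Ω` from `w₁` to `w₂`, parametrized on `[0,1]`. -/
def IsPathIn (Ω : Set ℂ) (w₁ w₂ : ℂ) (γ : ℝ → ℂ) : Prop :=
  γ 0 = w₁ ∧ γ 1 = w₂ ∧ (∀ t ∈ Set.Icc (0:ℝ) 1, γ t ∈ Ω) ∧
    ContDiffOn ℝ 1 γ (Set.Icc (0:ℝ) 1)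

/-- The Hurwitz distance: infimum of Hurwitz lengths of rectifiable paths in `Ω`. -/
def hurwitzDist (Ω : Set ℂ) (w₁ w₂ : ℂ) : ℝ :=
  sInf { L : ℝ | ∃ γ : ℝ → ℂ, IsPathIn Ω w₁ w₂ γ ∧
    L = ∫ t in (0:ℝ)..1, hurwitzDensity Ω (γ t) * ‖derivWithin γ (Set.Icc (0:ℝ) 1) t‖ }

/-- The generalized Hurwitz density `η_Ω^Y(w)` with basepoint domain `Y`
(`+∞` if no admissible map exists). -/
def genHurwitzDensity (Y Ω : Set ℂ) (w : ℂ) : ℝ≥0∞ :=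
  sInf { x : ℝ≥0∞ | ∃ s ∈ Y, ∃ h : ℂ → ℂ, DifferentiableOn ℂ h Y ∧
    Set.MapsTo h Y Ω ∧ h s = w ∧ (∀ t ∈ Y, t ≠ s → h t ≠ w) ∧ deriv h s ≠ 0 ∧
    x = ENNReal.ofReal (hurwitzDensity Y s / ‖deriv h s‖) }

/-- The generalized Hurwitz distance `η_Ω^Y(z₁,z₂)`. -/
def genHurwitzDist (Y Ω : Set ℂ) (z₁ z₂ : ℂ) : ℝ≥0∞ :=
  sInf { L : ℝ≥0∞ | ∃ γ : ℝ → ℂ, IsPathIn Ω z₁ z₂ γ ∧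
    L = ∫⁻ t in Set.Icc (0:ℝ) 1,
      genHurwitzDensity Y Ω (γ t) * ENNReal.ofReal ‖derivWithin γ (Set.Icc (0:ℝ) 1) t‖ }

/-- The infinitesimal contraction constant `l_η(Ω, Y)`. -/
def lEta (Ω Y : Set ℂ) : ℝ :=
  sSup { x : ℝ | ∃ w ∈ Ω, x = hurwitzDensity Y w / hurwitzDensity Ω w }

/-- The global contraction constant `gl_η(Ω, Y)`. -/
def glEta (Ω Y : Set ℂ) : ℝ :=
  sSup { x : ℝ | ∃ w₁ ∈ Ω, ∃ w₂ ∈ Ω, w₁ ≠ w₂ ∧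
    x = hurwitzDist Y w₁ w₂ / hurwitzDist Ω w₁ w₂ }

open scoped Topology unitInterval Pointwise

/-- A continuous lift of a nonconstant holomorphic function through a nonconstant holomorphic
function is holomorphic. -/
lemma differentiableOn_of_continuousOn_lift {U Y : Set ℂ} {f F g : ℂ → ℂ} {u a : ℂ}
    (hU : IsOpen U) (hUc : IsPreconnected U) (hY : IsOpen Y) (hYc : IsPreconnected Y)
    (hf : DifferentiableOn ℂ f U) (hu : u ∈ U) (hfu : deriv f u ≠ 0)
    (hg : DifferentiableOn ℂ g Y) (ha : a ∈ Y) (hga : deriv g a ≠ 0)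
    (hF : ContinuousOn F U) (hFY : MapsTo F U Y) (hgF : ∀ z ∈ U, g (F z) = f z) :
    DifferentiableOn ℂ F U := by
  have hfa : AnalyticOnNhd ℂ f U := hf.analyticOnNhd hU
  have hgan : AnalyticOnNhd ℂ g Y := hg.analyticOnNhd hY
  have regular : ∀ z ∈ U, deriv g (F z) ≠ 0 → DifferentiableAt ℂ F z := by
    intro z hz hgz
    have hFz : ContinuousAt F z := hF.continuousAt (hU.mem_nhds hz)
    have hs := (hgan _ (hFY hz)).hasStrictDerivAt
    have hinv := (hs.to_localInverse hgz).hasDerivAt.differentiableAt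
    rw [hgF z hz] at hinv
    refine (hinv.comp z (hf.differentiableAt (hU.mem_nhds hz))).congr_of_eventuallyEq ?_
    filter_upwards [hFz.eventually (hs.eventually_left_inverse hgz), hU.mem_nhds hz]
      with y hy hyU
    rw [Function.comp_apply, ← hgF y hyU, hy]
  intro z hz
  refine DifferentiableAt.differentiableWithinAt ?_
  have hFz : ContinuousAt F z := hF.continuousAt (hU.mem_nhds hz)
  have h1 : ∀ᶠ y in 𝓝[≠] z, f y ≠ f z := by
    refine ((hfa z hz).eventually_eq_or_eventually_ne analyticAt_const).resolve_left fun h ↦ hfu ?_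
    have hc := hfa.eqOn_of_preconnected_of_eventuallyEq (g := fun _ ↦ f z)
      (fun _ _ ↦ analyticAt_const) hUc hz h
    rw [(hc.eventuallyEq_of_mem (hU.mem_nhds hu)).deriv_eq, deriv_const]
  have h2 : ∀ᶠ p in 𝓝[≠] (F z), deriv g p ≠ 0 := by
    refine ((hgan.deriv _ (hFY hz)).eventually_eq_or_eventually_ne
      analyticAt_const).resolve_left fun h ↦ hga ?_
    exact hgan.deriv.eqOn_of_preconnected_of_eventuallyEq (g := fun _ ↦ 0)
      (fun _ _ ↦ analyticAt_const) hYc (hFY hz) h ha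
  have hUz : ∀ᶠ y in 𝓝[≠] z, y ∈ U := nhdsWithin_le_nhds (hU.mem_nhds hz)
  have h3 : Filter.Tendsto F (𝓝[≠] z) (𝓝[≠] (F z)) := by
    refine tendsto_nhdsWithin_iff.2 ⟨hFz.tendsto.mono_left nhdsWithin_le_nhds, ?_⟩
    filter_upwards [h1, hUz] with y hy hyU hyz
    rw [mem_singleton_iff] at hyz
    exact hy (by rw [← hgF y hyU, ← hgF z hz, hyz])
  have h4 : ∀ᶠ y in 𝓝[≠] z, DifferentiableAt ℂ F y := by
    filter_upwards [h3.eventually h2, hUz] with y hy hyU using regular y hyU hy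
  exact (Complex.analyticAt_of_differentiable_on_punctured_nhds_of_continuousAt h4
    hFz).differentiableAt

/-- A holomorphic map `f` of the disk into `Ω` taking the value `b` only at `0` lifts continuously
through a map `g` with `g a = b` which is a covering of `Ω \ {b}` by `Y \ {a}` and is locally
invertible at `a`. -/
lemma exists_continuousOn_lift {Ω Y : Set ℂ} {f g : ℂ → ℂ} {a b : ℂ} (hY : IsOpen Y)
    (hf : DifferentiableOn ℂ f unitDisk) (hfΩ : MapsTo f unitDisk Ω) (hf0 : f 0 = b)
    (hfb : ∀ t ∈ unitDisk, t ≠ 0 → f t ≠ b)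
    (hg : DifferentiableOn ℂ g Y) (ha : a ∈ Y) (hgab : g a = b) (hga : deriv g a ≠ 0)
    (hm : MapsTo g (Y \ {a}) (Ω \ {b}))
    (hcov : IsCoveringMap (MapsTo.restrict g (Y \ {a}) (Ω \ {b}) hm)) :
    ∃ F : ℂ → ℂ, ContinuousOn F unitDisk ∧ MapsTo F unitDisk Y ∧ F 0 = a ∧
      (∀ t ∈ unitDisk, t ≠ 0 → F t ≠ a) ∧ ∀ t ∈ unitDisk, g (F t) = f t := by
  have hD : IsOpen unitDisk := isOpen_ball
  have h0D : (0 : ℂ) ∈ unitDisk := mem_ball_self one_pos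
  have hfc : ContinuousAt f 0 := hf.continuousOn.continuousAt (hD.mem_nhds h0D)
  have hgan : AnalyticAt ℂ g a := hg.analyticOnNhd hY a ha
  have hs := hgan.hasStrictDerivAt
  obtain ⟨G, hG, hGb, hgG⟩ : ∃ G : ℂ → ℂ, AnalyticAt ℂ G b ∧ G b = a ∧
      ∀ᶠ y in 𝓝 b, g (G y) = y := by
    refine ⟨hs.localInverse _ _ _ hga, ?_, ?_, ?_⟩
    · rw [← hgab]; exact hgan.analyticAt_localInverse hga
    · rw [← hgab]; exact HasStrictFDerivAt.localInverse_apply_image ..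
    · rw [← hgab]; exact hs.eventually_right_inverse hga
  have hfc' : Filter.Tendsto f (𝓝 0) (𝓝 b) := hf0 ▸ hfc.tendsto
  have hev : ∀ᶠ z in 𝓝 (0 : ℂ), ContinuousAt (fun z ↦ G (f z)) z ∧ g (G (f z)) = f z ∧
      G (f z) ∈ Y := by
    have hGY : ∀ᶠ y in 𝓝 b, G y ∈ Y :=
      hG.continuousAt.eventually (by rw [hGb]; exact hY.mem_nhds ha)
    filter_upwards [hfc'.eventually hG.eventually_analyticAt, hfc'.eventually hgG,
      hfc'.eventually hGY, hD.mem_nhds h0D] with z h1 h2 h3 h4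
    exact ⟨h1.continuousAt.comp (hf.continuousOn.continuousAt (hD.mem_nhds h4)), h2, h3⟩
  obtain ⟨δ, hδ, hball⟩ := Metric.eventually_nhds_iff_ball.1 hev
  obtain ⟨ε, hε, hε1, hεδ⟩ : ∃ ε : ℝ, 0 < ε ∧ ε < 1 ∧ ε < δ :=
    ⟨min (1 / 2) (δ / 2), by positivity, by
      have := min_le_left (1 / 2) (δ / 2); linarith, by
      have := min_le_right (1 / 2) (δ / 2); linarith⟩
  let A := ↥(unitDisk \ {(0 : ℂ)})
  let c : I → ℝ := fun t ↦ ε + t * (1 - ε)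
  have hcc : Continuous c := by fun_prop
  have hcpos : ∀ t, 0 < c t := fun t ↦ by
    have := mul_nonneg t.2.1 (sub_nonneg.2 hε1.le)
    simp only [c]; linarith
  have hcle : ∀ t, c t ≤ 1 := fun t ↦ by
    have := mul_le_mul_of_nonneg_right t.2.2 (sub_nonneg.2 hε1.le)
    simp only [c]; linarith
  have hscale : ∀ (t : I) (z : ℂ), ‖(c t : ℂ) * z‖ ≤ ‖z‖ := fun t z ↦ by
    rw [norm_mul, Complex.norm_real, Real.norm_of_nonneg (hcpos t).le]
    exact mul_le_of_le_one_left (norm_nonneg _) (hcle t)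
  have hne : ∀ (t : I) (z : ℂ), z ≠ 0 → (c t : ℂ) * z ≠ 0 := fun t z hz ↦
    mul_ne_zero (by exact_mod_cast (hcpos t).ne') hz
  have hmem : ∀ (t : I) (z : A), (c t : ℂ) * z.1 ∈ unitDisk := fun t z ↦ by
    have := z.2.1
    simp only [unitDisk, mem_ball_zero_iff] at this ⊢
    exact (hscale t z.1).trans_lt this
  have hGne : ∀ z ∈ unitDisk, z ≠ 0 → g (G (f z)) = f z → G (f z) ≠ a := by
    intro z hz hz0 h1 h2
    exact hfb z hz hz0 (by rw [← h1, h2, hgab])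
  let H : C(I × A, ↥(Ω \ {b})) :=
    { toFun := fun p ↦ ⟨f ((c p.1 : ℂ) * p.2.1), hfΩ (hmem _ _),
        hfb _ (hmem _ _) (hne _ _ p.2.2.2)⟩
      continuous_toFun := Continuous.subtype_mk
        (hf.continuousOn.comp_continuous
          ((Complex.continuous_ofReal.comp (hcc.comp continuous_fst)).mul
            (continuous_subtype_val.comp continuous_snd)) fun p ↦ hmem _ _) _ }
  have hc0 : c 0 = ε := by simp [c]
  have hc1 : c 1 = 1 := by simp [c]
  have hεball : ∀ z : A, (ε : ℂ) * z.1 ∈ ball (0 : ℂ) δ := fun z ↦ by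
    have := z.2.1
    simp only [unitDisk, mem_ball_zero_iff] at this ⊢
    rw [norm_mul, Complex.norm_real, Real.norm_of_nonneg hε.le]
    nlinarith [norm_nonneg z.1]
  have hεmem : ∀ z : A, (ε : ℂ) * z.1 ∈ unitDisk := fun z ↦ hc0 ▸ hmem 0 z
  have hεne : ∀ z : A, (ε : ℂ) * z.1 ≠ 0 := fun z ↦ hc0 ▸ hne 0 z.1 z.2.2
  let F₀ : C(A, ↥(Y \ {a})) :=
    { toFun := fun z ↦ ⟨G (f ((ε : ℂ) * z.1)), (hball _ (hεball z)).2.2,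
        hGne _ (hεmem z) (hεne z) (hball _ (hεball z)).2.1⟩
      continuous_toFun := Continuous.subtype_mk (by
        have hGc : ContinuousOn (fun z ↦ G (f z)) (ball 0 δ) := fun z hz ↦
          (hball z hz).1.continuousWithinAt
        exact hGc.comp_continuous (by fun_prop) hεball) _ }
  have hH0 : ∀ z, H (0, z) = MapsTo.restrict g (Y \ {a}) (Ω \ {b}) hm (F₀ z) := by
    intro z
    apply Subtype.ext
    change f ((c 0 : ℂ) * z.1) = g (G (f ((ε : ℂ) * z.1)))
    rw [hc0, (hball _ (hεball z)).2.1]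
  let L := hcov.liftHomotopy H F₀ hH0
  have hL : ∀ z : A, g (L (1, z)).1 = f z.1 := by
    intro z
    have := congrArg Subtype.val (congrFun (hcov.liftHomotopy_lifts H F₀ hH0) (1, z))
    change g (L (1, z)).1 = f ((c 1 : ℂ) * z.1) at this
    rw [this, hc1, Complex.ofReal_one, one_mul]
  have hLG : ∀ z : A, ‖z.1‖ < δ → (L (1, z)).1 = G (f z.1) := by
    intro z hz
    have hb : ∀ t : I, (c t : ℂ) * z.1 ∈ ball (0 : ℂ) δ := fun t ↦
      mem_ball_zero_iff.2 ((hscale t _).trans_lt hz)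
    let Γ : I → ↥(Y \ {a}) := fun t ↦ ⟨G (f ((c t : ℂ) * z.1)), (hball _ (hb t)).2.2,
      hGne _ (hmem t z) (hne t _ z.2.2) (hball _ (hb t)).2.1⟩
    have hΓ : Continuous Γ := Continuous.subtype_mk (by
      have hGc : ContinuousOn (fun z ↦ G (f z)) (ball 0 δ) := fun z hz ↦
        (hball z hz).1.continuousWithinAt
      exact hGc.comp_continuous (by fun_prop) hb) _
    have heq : Γ = fun t ↦ L (t, z) := by
      refine hcov.eq_of_comp_eq hΓ (L.continuous.comp (by fun_prop)) ?_ 0 ?_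
      · funext t
        have := congrFun (hcov.liftHomotopy_lifts H F₀ hH0) (t, z)
        refine Eq.trans ?_ this.symm
        exact Subtype.ext (hball _ (hb t)).2.1
      · refine Eq.trans ?_ (hcov.liftHomotopy_zero H F₀ hH0 z).symm
        apply Subtype.ext
        change G (f ((c 0 : ℂ) * z.1)) = G (f ((ε : ℂ) * z.1))
        rw [hc0]
    have := congrArg Subtype.val (congrFun heq 1)
    rw [← this]
    change G (f ((c 1 : ℂ) * z.1)) = _
    rw [hc1, Complex.ofReal_one, one_mul]
  classical
  let F : ℂ → ℂ := fun z ↦ if hz : z ∈ unitDisk \ {(0 : ℂ)} then (L (1, ⟨z, hz⟩)).1 else a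
  have hFL : ∀ z (hz : z ∈ unitDisk \ {(0 : ℂ)}), F z = (L (1, ⟨z, hz⟩)).1 := fun z hz ↦
    dif_pos hz
  have hF0 : F 0 = a := dif_neg fun h ↦ h.2 rfl
  refine ⟨F, ?_, ?_, hF0, ?_, ?_⟩
  · intro z hz
    refine ContinuousAt.continuousWithinAt ?_
    by_cases hz0 : z = 0
    · subst hz0
      refine (hball 0 (mem_ball_self hδ)).1.congr ?_
      filter_upwards [hD.mem_nhds h0D, ball_mem_nhds 0 hδ] with y hy hyδ
      by_cases hy0 : y = 0
      · rw [hy0, hF0, hf0, hGb]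
      · rw [hFL y ⟨hy, hy0⟩, hLG ⟨y, hy, hy0⟩ (mem_ball_zero_iff.1 hyδ)]
    · have hop : IsOpen (unitDisk \ {(0 : ℂ)}) := hD.sdiff isClosed_singleton
      refine ContinuousOn.continuousAt ?_ (hop.mem_nhds ⟨hz, hz0⟩)
      rw [continuousOn_iff_continuous_domRestrict]
      have : (unitDisk \ {(0 : ℂ)}).domRestrict F = fun z : A ↦ (L (1, z)).1 :=
        funext fun z ↦ hFL z.1 z.2
      rw [this]
      exact continuous_subtype_val.comp (L.continuous.comp (by fun_prop))
  · intro z hz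
    by_cases hz0 : z = 0
    · rw [hz0, hF0]; exact ha
    · rw [hFL z ⟨hz, hz0⟩]; exact (L (1, ⟨z, hz, hz0⟩)).2.1
  · intro z hz hz0
    rw [hFL z ⟨hz, hz0⟩]; exact (L (1, ⟨z, hz, hz0⟩)).2.2
  · intro z hz
    by_cases hz0 : z = 0
    · rw [hz0, hF0, hgab, hf0]
    · rw [hFL z ⟨hz, hz0⟩, hL]

/-- The set of admissible derivatives whose supremum is the Hurwitz radius. -/
def hurwitzSet (Ω : Set ℂ) (w : ℂ) : Set ℝ :=
  { r : ℝ | 0 < r ∧ ∃ h : ℂ → ℂ, DifferentiableOn ℂ h unitDisk ∧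
    Set.MapsTo h unitDisk Ω ∧ h 0 = w ∧ (∀ t ∈ unitDisk, t ≠ 0 → h t ≠ w) ∧
    deriv h 0 = (r : ℂ) }

/-- By rotating the disk, the derivative at the origin may be normalized to be positive. -/
lemma norm_deriv_mem_hurwitzSet {Ω : Set ℂ} {w : ℂ} {h : ℂ → ℂ}
    (hd : DifferentiableOn ℂ h unitDisk) (hΩ : MapsTo h unitDisk Ω) (h0 : h 0 = w)
    (hw : ∀ t ∈ unitDisk, t ≠ 0 → h t ≠ w) (hh : deriv h 0 ≠ 0) :
    ‖deriv h 0‖ ∈ hurwitzSet Ω w := by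
  have hn : ‖deriv h 0‖ ≠ 0 := norm_ne_zero_iff.2 hh
  set u : ℂ := ‖deriv h 0‖ / deriv h 0 with hu
  have hu1 : ‖u‖ = 1 := by simp [hu, hn]
  have hu0 : u ≠ 0 := norm_ne_zero_iff.1 (by simp [hu1])
  have hm : MapsTo (fun z ↦ u * z) unitDisk unitDisk := fun z hz ↦ by
    simp only [unitDisk, mem_ball_zero_iff] at hz ⊢
    rwa [norm_mul, hu1, one_mul]
  refine ⟨norm_pos_iff.2 hh, fun z ↦ h (u * z), hd.comp (by fun_prop) hm, hΩ.comp hm,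
    by simp [h0], fun t ht ht0 ↦ hw _ (hm ht) (mul_ne_zero hu0 ht0), ?_⟩
  rw [deriv_comp_mul_left, mul_zero, smul_eq_mul, hu, div_mul_cancel₀ _ hh]

lemma hurwitzSet_nonempty {Ω : Set ℂ} (hΩ : IsOpen Ω) {w : ℂ} (hw : w ∈ Ω) :
    (hurwitzSet Ω w).Nonempty := by
  obtain ⟨ε, hε, hball⟩ := Metric.isOpen_iff.1 hΩ w hw
  have hε' : (ε : ℂ) ≠ 0 := by exact_mod_cast hε.ne'
  refine ⟨ε, hε, fun z ↦ w + ε * z, by fun_prop, fun z hz ↦ hball ?_, by simp,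
    fun t _ ht0 h ↦ mul_ne_zero hε' ht0 (add_eq_left.1 h), ?_⟩
  · rw [unitDisk, mem_ball_zero_iff] at hz
    rw [mem_ball_iff_norm, add_sub_cancel_left, norm_mul, Complex.norm_real,
      Real.norm_of_nonneg hε.le]
    exact mul_lt_of_lt_one_right hε hz
  · simp

/-- Post-composition with an admissible map scales admissible derivatives. -/
lemma mul_mem_hurwitzSet {Ω Y : Set ℂ} {h : ℂ → ℂ} {s w : ℂ} {r : ℝ} (hY : IsOpen Y)
    (hs : s ∈ Y) (hd : DifferentiableOn ℂ h Y) (hm : MapsTo h Y Ω) (hsw : h s = w)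
    (hw : ∀ t ∈ Y, t ≠ s → h t ≠ w) (hh : deriv h s ≠ 0) (hr : r ∈ hurwitzSet Y s) :
    ‖deriv h s‖ * r ∈ hurwitzSet Ω w := by
  obtain ⟨hr0, f, hf, hfY, hf0, hfs, hfr⟩ := hr
  have hderiv : deriv (h ∘ f) 0 = deriv h s * r := by
    rw [deriv_comp 0 (by rw [hf0]; exact hd.differentiableAt (hY.mem_nhds hs))
      (hf.differentiableAt (isOpen_ball.mem_nhds (mem_ball_self one_pos))), hf0, hfr]
  have hr' : (r : ℂ) ≠ 0 := by exact_mod_cast hr0.ne'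
  have := norm_deriv_mem_hurwitzSet (h := h ∘ f) (hd.comp hf hfY) (hm.comp hfY)
    (by simp [hf0, hsw]) (fun t ht ht0 ↦ hw _ (hfY ht) (hfs t ht ht0))
    (by rw [hderiv]; exact mul_ne_zero hh hr')
  rwa [hderiv, norm_mul, Complex.norm_real, Real.norm_of_nonneg hr0.le] at this

/-- The Hurwitz density does not increase under admissible maps. -/
lemma hurwitzDensity_le_div {Ω Y : Set ℂ} {h : ℂ → ℂ} {s w : ℂ} (hY : IsOpen Y)
    (hs : s ∈ Y) (hd : DifferentiableOn ℂ h Y) (hm : MapsTo h Y Ω) (hsw : h s = w)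
    (hw : ∀ t ∈ Y, t ≠ s → h t ≠ w) (hh : deriv h s ≠ 0) :
    hurwitzDensity Ω w ≤ hurwitzDensity Y s / ‖deriv h s‖ := by
  have hn : 0 < ‖deriv h s‖ := norm_pos_iff.2 hh
  have hmul := fun r (hr : r ∈ hurwitzSet Y s) ↦ mul_mem_hurwitzSet hY hs hd hm hsw hw hh hr
  change 2 / sSup (hurwitzSet Ω w) ≤ 2 / sSup (hurwitzSet Y s) / ‖deriv h s‖
  by_cases hbdd : BddAbove (hurwitzSet Ω w)
  · have hle : ∀ r ∈ hurwitzSet Y s, r ≤ sSup (hurwitzSet Ω w) / ‖deriv h s‖ := fun r hr ↦ by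
      rw [le_div_iff₀ hn, mul_comm]
      exact le_csSup hbdd (hmul r hr)
    obtain ⟨r, hr⟩ := hurwitzSet_nonempty hY hs
    have hpos : 0 < sSup (hurwitzSet Y s) := hr.1.trans_le (le_csSup ⟨_, hle⟩ hr)
    rw [div_div]
    refine div_le_div_of_nonneg_left zero_le_two (mul_pos hpos hn) ?_
    rw [← le_div_iff₀ hn]
    exact csSup_le ⟨r, hr⟩ hle
  · rw [Real.sSup_of_not_bddAbove hbdd, div_zero]
    have : 0 ≤ sSup (hurwitzSet Y s) := Real.sSup_nonneg fun r hr ↦ hr.1.le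
    positivity

/-- Coverings of Hurwitz type are local isometries for the Hurwitz density. -/
lemma hurwitzDensity_div_eq_of_covering {Ω Y : Set ℂ} {g : ℂ → ℂ} {a b : ℂ}
    (hY : IsPlaneDomain Y) (hg : DifferentiableOn ℂ g Y) (hgΩ : MapsTo g Y Ω) (ha : a ∈ Y)
    (hgab : g a = b) (hga : deriv g a ≠ 0) (hm : MapsTo g (Y \ {a}) (Ω \ {b}))
    (hcov : IsCoveringMap (MapsTo.restrict g (Y \ {a}) (Ω \ {b}) hm)) :
    hurwitzDensity Y a / ‖deriv g a‖ = hurwitzDensity Ω b := by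
  have hn : 0 < ‖deriv g a‖ := norm_pos_iff.2 hga
  have h0 : (0 : ℂ) ∈ unitDisk := mem_ball_self one_pos
  have hD : IsOpen unitDisk := isOpen_ball
  have hset : hurwitzSet Ω b = ‖deriv g a‖ • hurwitzSet Y a := by
    apply Subset.antisymm
    · rintro r ⟨hr, f, hf, hfΩ, hf0, hfb, hfr⟩
      obtain ⟨F, hFc, hFY, hF0, hFa, hgF⟩ :=
        exists_continuousOn_lift hY.1 hf hfΩ hf0 hfb hg ha hgab hga hm hcov
      have hr' : (r : ℂ) ≠ 0 := by exact_mod_cast hr.ne'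
      have hF : DifferentiableOn ℂ F unitDisk :=
        differentiableOn_of_continuousOn_lift hD (convex_ball _ _).isPreconnected hY.1
          hY.2.isPreconnected hf h0 (by rwa [hfr]) hg ha hga hFc hFY hgF
      have hderiv : deriv g a * deriv F 0 = r := by
        rw [← hfr, ← hF0, ← deriv_comp 0
          (by rw [hF0]; exact hg.differentiableAt (hY.1.mem_nhds ha))
          (hF.differentiableAt (hD.mem_nhds h0))]
        exact Filter.EventuallyEq.deriv_eq
          (Filter.eventuallyEq_of_mem (hD.mem_nhds h0) fun t ht ↦ hgF t ht)
      refine ⟨‖deriv F 0‖, norm_deriv_mem_hurwitzSet hF hFY hF0 hFa fun h ↦ hr' ?_, ?_⟩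
      · rw [← hderiv, h, mul_zero]
      · change ‖deriv g a‖ * ‖deriv F 0‖ = r
        rw [← norm_mul, hderiv, Complex.norm_real, Real.norm_of_nonneg hr.le]
    · rintro _ ⟨r, hr, rfl⟩
      exact mul_mem_hurwitzSet hY.1 ha hg hgΩ hgab (fun t ht hta ↦ (hm ⟨ht, hta⟩).2) hga hr
  change 2 / sSup (hurwitzSet Y a) / ‖deriv g a‖ = 2 / sSup (hurwitzSet Ω b)
  rw [hset, Real.sSup_smul_of_nonneg hn.le, smul_eq_mul, div_div, mul_comm]

/-- if every point of `Ω` admits a Hurwitz-type holomorphic covering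
from `Y`, then the generalized and ordinary Hurwitz densities coincide. -/
theorem genHurwitz_eq_hurwitz_of_coverings
    (Ω Y : Set ℂ) (hΩ : IsPlaneDomain Ω) (hY : IsPlaneDomain Y)
    (hΩp : Ω ≠ Set.univ) (hYp : Y ≠ Set.univ)
    (hcov : ∀ b ∈ Ω, ∃ a ∈ Y, ∃ hb : ℂ → ℂ,
      DifferentiableOn ℂ hb Y ∧ Set.MapsTo hb Y Ω ∧ Set.SurjOn hb Y Ω ∧
      hb a = b ∧ deriv hb a ≠ 0 ∧
      ∃ hm : Set.MapsTo hb (Y \ {a}) (Ω \ {b}),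
        Set.SurjOn hb (Y \ {a}) (Ω \ {b}) ∧
        IsCoveringMap (Set.MapsTo.restrict hb (Y \ {a}) (Ω \ {b}) hm)) :
    ∀ w ∈ Ω, genHurwitzDensity Y Ω w = ENNReal.ofReal (hurwitzDensity Ω w) := by
  intro w hw
  apply le_antisymm
  · obtain ⟨a, ha, g, hg, hgΩ, -, hgab, hga, hm, -, hc⟩ := hcov w hw
    refine sInf_le ⟨a, ha, g, hg, hgΩ, hgab, fun t ht hta ↦ (hm ⟨ht, hta⟩).2, hga, ?_⟩
    rw [hurwitzDensity_div_eq_of_covering hY hg hgΩ ha hgab hga hm hc]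
  · refine le_sInf ?_
    rintro _ ⟨s, hs, h, hd, hm, hsw, hne, hh, rfl⟩
    exact ENNReal.ofReal_le_ofReal (hurwitzDensity_le_div hY.1 hs hd hm hsw hne hh)
end
end

section
/- For every proper subdomain Ω of ℂ, the generalized Hurwitz density of Ω with basepoint domain Ω itself coincides with the Hurwitz density: η_Ω^Ω(w) = η_Ω(w) for every w ∈ Ω. -/
open Complex Set Metric
open scoped ENNReal

noncomputable section

/-- The set of derivatives at the origin of the maps competing in the Hurwitz radius. -/
def hurwitzDerivs (Ω : Set ℂ) (w : ℂ) : Set ℝ :=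
  { r : ℝ | 0 < r ∧ ∃ h : ℂ → ℂ, DifferentiableOn ℂ h unitDisk ∧
    Set.MapsTo h unitDisk Ω ∧ h 0 = w ∧ (∀ t ∈ unitDisk, t ≠ 0 → h t ≠ w) ∧
    deriv h 0 = (r : ℂ) }

lemma hurwitzRadius_eq_sSup (Ω : Set ℂ) (w : ℂ) :
    hurwitzRadius Ω w = sSup (hurwitzDerivs Ω w) := rfl

/-- Affine maps onto small disks show that the Hurwitz radius has competitors. -/
lemma hurwitzDerivs_nonempty {Ω : Set ℂ} (hΩ : IsOpen Ω) {w : ℂ} (hw : w ∈ Ω) :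
    (hurwitzDerivs Ω w).Nonempty := by
  obtain ⟨ε, hε, hball⟩ := Metric.isOpen_iff.1 hΩ w hw
  have hε' : (ε : ℂ) ≠ 0 := by exact_mod_cast hε.ne'
  refine ⟨ε, hε, fun t => w + ε * t, by fun_prop, ?_, by simp, ?_, ?_⟩
  · intro t ht
    apply hball
    have ht' : ‖t‖ < 1 := by simpa [unitDisk] using ht
    rw [Metric.mem_ball, dist_eq_norm, add_sub_cancel_left, norm_mul, Complex.norm_real,
      Real.norm_of_nonneg hε.le]
    nlinarith
  · intro t _ ht0 h
    simp [hε', ht0] at h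
  · simp

/-- Composition with a map attaining `w` only at `s` sends competitors at `s` to
competitors at `w`. -/
lemma norm_deriv_mul_mem_hurwitzDerivs {Y Ω : Set ℂ} (hY : IsOpen Y) {s w : ℂ} (hs : s ∈ Y)
    {h : ℂ → ℂ} (hd : DifferentiableOn ℂ h Y) (hm : Set.MapsTo h Y Ω) (hsw : h s = w)
    (hne : ∀ t ∈ Y, t ≠ s → h t ≠ w) (h' : deriv h s ≠ 0) {r : ℝ} (hr : r ∈ hurwitzDerivs Y s) :
    ‖deriv h s‖ * r ∈ hurwitzDerivs Ω w := by
  obtain ⟨hr0, g, gd, gm, g0, gne, g'⟩ := hr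
  set a := deriv h s with ha
  have hna : (‖a‖ : ℂ) ≠ 0 := by simpa using h'
  set u : ℂ := ‖a‖ / a with hu
  have hau : a * u = ‖a‖ := by rw [hu]; field_simp
  have hu0 : u ≠ 0 := div_ne_zero hna h'
  have hun : ‖u‖ = 1 := by
    rw [hu, norm_div, Complex.norm_real, norm_norm, div_self (norm_ne_zero_iff.2 h')]
  have hrot : Set.MapsTo (fun t : ℂ => u * t) unitDisk unitDisk := by
    intro t ht
    simpa [unitDisk, hun] using ht
  refine ⟨mul_pos (norm_pos_iff.2 h') hr0, fun t => h (g (u * t)), ?_, ?_, ?_, ?_, ?_⟩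
  · exact hd.comp (gd.comp (by fun_prop) hrot) (gm.comp hrot)
  · exact hm.comp (gm.comp hrot)
  · simp [g0, hsw]
  · intro t ht ht0
    exact hne _ (gm (hrot ht)) (gne _ (hrot ht) (mul_ne_zero hu0 ht0))
  · have e0 : HasDerivAt (fun t : ℂ => u * t) u 0 := by
      simpa using (hasDerivAt_id (0 : ℂ)).const_mul u
    have e1 : HasDerivAt g (r : ℂ) (u * 0) := by
      rw [mul_zero, ← g']
      exact (gd.differentiableAt (Metric.isOpen_ball.mem_nhds (by simp))).hasDerivAt
    have e2 : HasDerivAt h a (g (u * 0)) := by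
      rw [mul_zero, g0]
      exact (hd.differentiableAt (hY.mem_nhds hs)).hasDerivAt
    have e3 : HasDerivAt (fun t => g (u * t)) (r * u) 0 := e1.comp (0 : ℂ) e0
    have e4 : HasDerivAt (fun t => h (g (u * t))) (a * (r * u)) 0 :=
      HasDerivAt.comp (0 : ℂ) e2 e3
    rw [e4.deriv]
    push_cast
    rw [← hau]
    ring

/-- Contraction of the Hurwitz density under maps attaining `w` only at `s`. When the set of
competitors at `w` is unbounded, the density at `w` is `0` by convention. -/
lemma hurwitzDensity_le_div_norm_deriv {Y Ω : Set ℂ} (hY : IsOpen Y) {s w : ℂ} (hs : s ∈ Y)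
    {h : ℂ → ℂ} (hd : DifferentiableOn ℂ h Y) (hm : Set.MapsTo h Y Ω) (hsw : h s = w)
    (hne : ∀ t ∈ Y, t ≠ s → h t ≠ w) (h' : deriv h s ≠ 0) :
    hurwitzDensity Ω w ≤ hurwitzDensity Y s / ‖deriv h s‖ := by
  have ha : 0 < ‖deriv h s‖ := norm_pos_iff.2 h'
  have key {r : ℝ} (hr : r ∈ hurwitzDerivs Y s) : ‖deriv h s‖ * r ∈ hurwitzDerivs Ω w :=
    norm_deriv_mul_mem_hurwitzDerivs hY hs hd hm hsw hne h' hr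
  unfold hurwitzDensity
  rw [hurwitzRadius_eq_sSup, hurwitzRadius_eq_sSup]
  by_cases hb : BddAbove (hurwitzDerivs Ω w)
  · have hle : ∀ r ∈ hurwitzDerivs Y s, r ≤ sSup (hurwitzDerivs Ω w) / ‖deriv h s‖ := by
      intro r hr
      rw [le_div_iff₀ ha, mul_comm]
      exact le_csSup hb (key hr)
    obtain ⟨r₀, hr₀⟩ := hurwitzDerivs_nonempty hY hs
    have hpos : 0 < sSup (hurwitzDerivs Y s) := hr₀.1.trans_le (le_csSup ⟨_, hle⟩ hr₀)
    have hsup := csSup_le ⟨r₀, hr₀⟩ hle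
    rw [le_div_iff₀ ha] at hsup
    rw [div_div]
    exact div_le_div_of_nonneg_left zero_le_two (mul_pos hpos ha) hsup
  · rw [Real.sSup_of_not_bddAbove hb, div_zero]
    have : 0 ≤ sSup (hurwitzDerivs Y s) := Real.sSup_nonneg fun r hr => hr.1.le
    positivity

/-- the generalized Hurwitz density with basepoint domain `Ω`
itself coincides with the Hurwitz density. -/
theorem genHurwitz_self_eq_hurwitz
    (Ω : Set ℂ) (hΩ : IsPlaneDomain Ω) (hΩp : Ω ≠ Set.univ) (w : ℂ) (hw : w ∈ Ω) :
    genHurwitzDensity Ω Ω w = ENNReal.ofReal (hurwitzDensity Ω w) := by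
  apply le_antisymm
  · refine sInf_le ⟨w, hw, id, differentiableOn_id, Set.mapsTo_id Ω, rfl, fun t _ ht => ht, ?_, ?_⟩
    · simp
    · simp
  · refine le_sInf ?_
    rintro x ⟨s, hs, h, hd, hm, hsw, hne, h', rfl⟩
    exact ENNReal.ofReal_le_ofReal
      (hurwitzDensity_le_div_norm_deriv hΩ.1 hs hd hm hsw hne h')
end
end

section
/- (Distance decreasing property of the generalized Hurwitz density.) Let Ω and Δ be subdomains of ℂ and let Y ⊊ ℂ be a domain. If h is a holomorphic function from Ω to Δ with h(a) = b, h'(a) ≠ 0, and h(w) ≠ b for all w ∈ Ω∖{a}, then η_Δ^Y(h(a))·|h'(a)| ≤ η_Ω^Y(a). -/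
open Complex Set Metric
open scoped ENNReal

noncomputable section

/-- distance decreasing property of the generalized Hurwitz density. -/
theorem genHurwitz_distance_decreasing
    (Ω Δ Y : Set ℂ) (hΩ : IsPlaneDomain Ω) (hΔ : IsPlaneDomain Δ)
    (hY : IsPlaneDomain Y) (hYp : Y ≠ Set.univ)
    (h : ℂ → ℂ) (a b : ℂ) (ha : a ∈ Ω)
    (hhol : DifferentiableOn ℂ h Ω) (hmaps : Set.MapsTo h Ω Δ)
    (hab : h a = b) (hd : deriv h a ≠ 0) (hne : ∀ w ∈ Ω, w ≠ a → h w ≠ b) :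
    genHurwitzDensity Y Δ (h a) * ENNReal.ofReal ‖deriv h a‖
      ≤ genHurwitzDensity Y Ω a := by
  refine le_sInf ?_
  rintro x ⟨s, hs, f, hf, hfm, hfs, hfne, hfd, rfl⟩
  have hfs' : DifferentiableAt ℂ f s := hf.differentiableAt (hY.1.mem_nhds hs)
  have hha : DifferentiableAt ℂ h (f s) := by
    rw [hfs]
    exact hhol.differentiableAt (hΩ.1.mem_nhds ha)
  have hderiv : deriv (h ∘ f) s = deriv h a * deriv f s := by
    rw [deriv_comp s hha hfs', hfs]
  have hle : genHurwitzDensity Y Δ (h a)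
      ≤ ENNReal.ofReal (hurwitzDensity Y s / ‖deriv (h ∘ f) s‖) := by
    refine sInf_le ⟨s, hs, h ∘ f, hhol.comp hf hfm, hmaps.comp hfm, by simp [hfs], ?_, ?_, rfl⟩
    · intro t ht hts
      rw [hab]
      exact hne _ (hfm ht) (hfne t ht hts)
    · rw [hderiv]
      exact mul_ne_zero hd hfd
  refine (mul_le_mul_left hle _).trans_eq ?_
  rw [← ENNReal.ofReal_mul' (norm_nonneg _), hderiv, norm_mul]
  have h₁ : ‖deriv h a‖ ≠ 0 := norm_ne_zero_iff.mpr hd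
  congr 1
  field_simp
end
end

section
/- Let Y ⊊ ℂ be a domain. If Ω is a hyperbolic domain in ℂ, then the generalized Hurwitz distance η_Ω^Y(·,·) makes Ω a complete metric space: it is symmetric, satisfies the triangle inequality, is strictly positive on pairs of distinct points, and every Cauchy sequence with respect to it converges in Ω. -/
open Complex Set Metric
open scoped ENNReal

noncomputable section

/-- A nonvanishing holomorphic function on a disk has a holomorphic logarithm with prescribed
value at the center. -/
theorem exists_holomorphic_log_on_ball {f : ℂ → ℂ} {r : ℝ}
    (hf : DifferentiableOn ℂ f (ball 0 r)) (hf0 : ∀ z ∈ ball (0 : ℂ) r, f z ≠ 0)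
    {l : ℂ} (hl : exp l = f 0) :
    ∃ g : ℂ → ℂ, DifferentiableOn ℂ g (ball 0 r) ∧ g 0 = l ∧ ∀ z ∈ ball (0 : ℂ) r,
      exp (g z) = f z := by
  obtain ⟨g, hg0, hg⟩ := ((hf.deriv isOpen_ball).div hf hf0).isExactOn_ball.with_val_at 0 l
  refine ⟨g, fun z hz => (hg z hz).differentiableAt.differentiableWithinAt, hg0, ?_⟩
  have hder : ∀ z ∈ ball (0 : ℂ) r, HasDerivAt (fun z => exp (-g z) * f z) 0 z := by
    intro z hz
    have h1 := (hg z hz).neg.cexp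
    have h2 := (hf.differentiableAt (isOpen_ball.mem_nhds hz)).hasDerivAt
    refine (h1.mul h2).congr_deriv ?_
    have := hf0 z hz
    simp only [Pi.div_apply]
    field_simp
    ring
  intro z hz
  have h0 : (0 : ℂ) ∈ ball (0 : ℂ) r := by
    rw [mem_ball, dist_self]
    exact dist_nonneg.trans_lt hz
  have hconst : exp (-g z) * f z = exp (-g 0) * f 0 := by
    refine (convex_ball (0 : ℂ) r).is_const_of_fderivWithin_eq_zero (𝕜 := ℂ)
      (f := fun z => exp (-g z) * f z)
      (fun w hw => (hder w hw).differentiableAt.differentiableWithinAt) (fun w hw => ?_) hz h0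
    rw [fderivWithin_of_isOpen isOpen_ball hw, (hder w hw).hasFDerivAt.fderiv]
    simp
  rw [hg0, ← hl, ← exp_add, neg_add_cancel, exp_zero, exp_neg] at hconst
  field_simp at hconst
  exact hconst.symm

/-- Quantitative open mapping: a holomorphic map whose derivative on a disk is at most twice the
derivative at the center covers a disk of comparable size. -/
theorem ball_subset_image_of_norm_deriv_le {H : ℂ → ℂ} {p : ℂ} {t : ℝ} (ht : 0 < t)
    (hH : DifferentiableOn ℂ H (ball p t)) (hp : deriv H p ≠ 0)
    (hb : ∀ z ∈ ball p t, ‖deriv H z‖ ≤ 2 * ‖deriv H p‖) :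
    ball (H p) (‖deriv H p‖ * t / 24) ⊆ H '' ball p t := by
  set m := ‖deriv H p‖ with hm
  have hmpos : 0 < m := norm_pos_iff.2 hp
  have hpt : p ∈ ball p t := mem_ball_self ht
  have hschwarz : ∀ z ∈ ball p t, ‖deriv H z - deriv H p‖ ≤ 3 * m / t * ‖z - p‖ := by
    intro z hz
    rw [← dist_eq_norm, ← dist_eq_norm]
    refine dist_le_div_mul_dist_of_mapsTo_ball (hH.deriv isOpen_ball) (fun w hw => ?_) hz
    rw [mem_closedBall, dist_eq_norm]
    calc ‖deriv H w - deriv H p‖ ≤ ‖deriv H w‖ + ‖deriv H p‖ := norm_sub_le _ _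
      _ ≤ 3 * m := by linarith [hb w hw]
  have hsub : closedBall p (t / 6) ⊆ ball p t := closedBall_subset_ball (by linarith)
  have hlow : ∀ z ∈ sphere p (t / 6), m * t / 12 ≤ ‖H z - H p‖ := by
    intro z hz
    have hz' : ‖z - p‖ = t / 6 := by rwa [mem_sphere, dist_eq_norm] at hz
    have hmv : ‖(H z - deriv H p * z) - (H p - deriv H p * p)‖ ≤ m / 2 * ‖z - p‖ := by
      refine (convex_closedBall p (t / 6)).norm_image_sub_le_of_norm_hasDerivWithin_le
        (f := fun z => H z - deriv H p * z) (f' := fun z => deriv H z - deriv H p) ?_ ?_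
        (mem_closedBall_self (by positivity)) (sphere_subset_closedBall hz)
      · intro w hw
        have h1 := (hH.differentiableAt (isOpen_ball.mem_nhds (hsub hw))).hasDerivAt
        exact ((h1.sub ((hasDerivAt_id w).const_mul (deriv H p))).congr_deriv
          (by rw [mul_one])).hasDerivWithinAt
      · intro w hw
        refine (hschwarz w (hsub hw)).trans ?_
        rw [mem_closedBall, dist_eq_norm] at hw
        calc 3 * m / t * ‖w - p‖ ≤ 3 * m / t * (t / 6) := by gcongr
          _ = m / 2 := by field_simp; norm_num
    have htri : ‖deriv H p * (z - p)‖ ≤ ‖H z - H p‖ +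
        ‖(H z - deriv H p * z) - (H p - deriv H p * p)‖ := by
      have : deriv H p * (z - p) =
          (H z - H p) - ((H z - deriv H p * z) - (H p - deriv H p * p)) := by ring
      rw [this]
      exact norm_sub_le _ _
    rw [norm_mul, hz', ← hm] at htri
    rw [hz'] at hmv
    linarith
  have hcl : DiffContOnCl ℂ H (ball p (t / 6)) := by
    refine (hH.mono ?_).diffContOnCl
    rw [closure_ball p (by positivity)]
    exact hsub
  have hne : ∃ᶠ z in nhds p, H z ≠ H p := by
    have := (hH.differentiableAt (isOpen_ball.mem_nhds hpt)).hasDerivAt.eventually_ne hp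
      (c := H p)
    exact this.frequently.filter_mono nhdsWithin_le_nhds
  have := hcl.ball_subset_image_closedBall (by positivity) hlow hne
  refine Subset.trans ?_ (this.trans (image_mono hsub))
  exact ball_subset_ball (by linarith)

/-- **Bloch's theorem**: a holomorphic function on the unit disk whose image contains no disk of
radius `R` has derivative at most `96 * R` at the center. -/
theorem norm_deriv_le_of_image_contains_no_ball {H : ℂ → ℂ} {R : ℝ}
    (hH : DifferentiableOn ℂ H (ball 0 1))
    (hR : ∀ c : ℂ, ∃ v ∈ ball c R, v ∉ H '' ball 0 1) : ‖deriv H 0‖ ≤ 96 * R := by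
  by_contra! hlt
  have hRpos : 0 < R := by
    obtain ⟨v, hv, -⟩ := hR 0
    exact dist_nonneg.trans_lt hv
  have hsub : closedBall (0 : ℂ) (1 / 2) ⊆ ball 0 1 := closedBall_subset_ball (by norm_num)
  have hcont : ContinuousOn (fun z => (1 / 2 - ‖z‖) * ‖deriv H z‖) (closedBall (0 : ℂ) (1 / 2)) :=
    (by fun_prop : ContinuousOn (fun z : ℂ => 1 / 2 - ‖z‖) _).mul
      (((hH.deriv isOpen_ball).continuousOn.mono hsub).norm)
  obtain ⟨p, hp, hmax⟩ := (isCompact_closedBall (0 : ℂ) (1 / 2)).exists_isMaxOn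
    ⟨0, by simp⟩ hcont
  have hmax' : ∀ z : ℂ, ‖z‖ ≤ 1 / 2 →
      (1 / 2 - ‖z‖) * ‖deriv H z‖ ≤ (1 / 2 - ‖p‖) * ‖deriv H p‖ := fun z hz =>
    hmax (by simpa using hz)
  have h0 := hmax' 0 (by simp)
  rw [norm_zero, sub_zero] at h0
  have hp' : ‖p‖ ≤ 1 / 2 := by simpa using hp
  have hprod : 0 < (1 / 2 - ‖p‖) * ‖deriv H p‖ := by nlinarith
  have ht : 0 < 1 / 2 - ‖p‖ := pos_of_mul_pos_left hprod (norm_nonneg _)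
  have hm : 0 < ‖deriv H p‖ := pos_of_mul_pos_right hprod ht.le
  set t := (1 / 2 - ‖p‖) / 2 with ht_def
  have htpos : 0 < t := by positivity
  have hz : ∀ z ∈ ball p t, t ≤ 1 / 2 - ‖z‖ := by
    intro z hz
    rw [mem_ball, dist_eq_norm] at hz
    have := norm_sub_norm_le z p
    linarith
  have hsub' : ball p t ⊆ ball 0 1 := fun z hzt => by
    have := hz z hzt
    rw [mem_ball, dist_zero_right]
    linarith
  obtain ⟨v, hv, hvn⟩ := hR (H p)
  refine hvn (image_mono hsub' (ball_subset_image_of_norm_deriv_le htpos (hH.mono hsub')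
    (norm_pos_iff.1 hm) (fun z hzt => ?_) (ball_subset_ball ?_ hv)))
  · have h1 := hz z hzt
    have h2 := hmax' z (by linarith)
    have h3 : t * ‖deriv H z‖ ≤ t * (2 * ‖deriv H p‖) :=
      (mul_le_mul_of_nonneg_right h1 (norm_nonneg _)).trans (h2.trans_eq (by rw [ht_def]; ring))
    exact le_of_mul_le_mul_left h3 htpos
  · have : ‖deriv H p‖ * t = (1 / 2 - ‖p‖) * ‖deriv H p‖ / 2 := by rw [ht_def]; ring
    rw [this]
    linarith

/-- Every disk of radius `4` contains a point where the cosine is a nonzero integer. -/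
theorem exists_mem_ball_cos_eq_int (c : ℂ) : ∃ v ∈ ball c 4, ∃ n : ℤ, n ≠ 0 ∧ cos v = n := by
  have hreal : ∀ Y : ℝ, 0 ≤ Y → ∃ y : ℝ, |y - Y| ≤ 2 ∧ ∃ n : ℤ, 0 < n ∧ Real.cosh y = n := by
    intro Y hY
    have hcosh2 : (2 : ℝ) ≤ Real.cosh 2 := by
      have := Real.one_lt_cosh.2 (two_ne_zero (α := ℝ))
      have h3 : (2 : ℝ) + 1 ≤ Real.exp 2 := Real.add_one_le_exp 2
      have h4 : (2 : ℝ) ^ 2 ≤ Real.exp 2 := by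
        have : (2 : ℝ) ≤ Real.exp 1 := by linarith [Real.add_one_le_exp (1 : ℝ)]
        calc (2 : ℝ) ^ 2 ≤ Real.exp 1 ^ 2 := by gcongr
          _ = Real.exp 2 := by rw [← Real.exp_nat_mul]; norm_num
      rw [Real.cosh_eq]
      linarith [Real.exp_pos (-2 : ℝ)]
    have h1 : 1 ≤ Real.cosh Y := Real.one_le_cosh Y
    have hup : Real.cosh Y + 1 ≤ Real.cosh (Y + 2) := by
      rw [Real.cosh_add]
      have := mul_nonneg (Real.sinh_nonneg_iff.2 hY) (Real.sinh_nonneg_iff.2 zero_le_two)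
      nlinarith
    have hmem : ((⌈Real.cosh Y⌉ : ℤ) : ℝ) ∈ Icc (Real.cosh Y) (Real.cosh (Y + 2)) :=
      ⟨Int.le_ceil _, (Int.ceil_lt_add_one _).le.trans hup⟩
    obtain ⟨y, hy, hyn⟩ := intermediate_value_Icc (by linarith : Y ≤ Y + 2)
      Real.continuous_cosh.continuousOn hmem
    refine ⟨y, ?_, _, Int.ceil_pos.2 (by linarith), hyn⟩
    rw [abs_le]
    constructor <;> linarith [hy.1, hy.2]
  have hreal' : ∃ y : ℝ, |y - c.im| ≤ 2 ∧ ∃ n : ℤ, 0 < n ∧ Real.cosh y = n := by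
    rcases le_total 0 c.im with h | h
    · exact hreal _ h
    · obtain ⟨y, hy, n, hn⟩ := hreal (-c.im) (by linarith)
      refine ⟨-y, ?_, n, by simpa using hn⟩
      rw [abs_le] at hy ⊢
      constructor <;> linarith [hy.1, hy.2]
  obtain ⟨y, hy, n, hn, hyn⟩ := hreal'
  set m : ℤ := round (c.re / Real.pi) with hm
  have hx : |m * Real.pi - c.re| < 2 := by
    have h1 := abs_sub_round (c.re / Real.pi)
    have h2 : |c.re - m * Real.pi| = |c.re / Real.pi - m| * Real.pi := by
      rw [← abs_of_pos Real.pi_pos, ← abs_mul, abs_of_pos Real.pi_pos, sub_mul,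
        div_mul_cancel₀ _ Real.pi_ne_zero]
    rw [abs_sub_comm, h2]
    nlinarith [Real.pi_lt_four, Real.pi_pos]
  refine ⟨m * Real.pi + y * I, ?_, (-1) ^ m.natAbs * n, ?_, ?_⟩
  · rw [mem_ball, dist_eq_norm]
    refine (norm_le_abs_re_add_abs_im _).trans_lt ?_
    simp only [sub_re, add_re, mul_re, intCast_re, ofReal_re, intCast_im, ofReal_im, I_re, I_im,
      sub_im, add_im, mul_im]
    simp only [mul_zero, sub_zero, zero_mul, mul_one, add_zero, zero_add]
    linarith
  · exact mul_ne_zero (pow_ne_zero _ (by norm_num)) hn.ne'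
  · have hcosm : cos (m * Real.pi) = (-1) ^ m.natAbs := by
      have : cos (m * Real.pi) = (Real.cos (m * Real.pi) : ℝ) := by push_cast; rfl
      rw [this, Real.cos_int_mul_pi]
      push_cast
      rcases Int.even_or_odd m with h | h
      · rw [h.neg_one_zpow, (Int.natAbs_even.2 h).neg_one_pow]
      · rw [h.neg_one_zpow, (Int.natAbs_odd.2 h).neg_one_pow]
    rw [cos_add, hcosm, sin_int_mul_pi, cos_mul_I, ← ofReal_cosh, hyn]
    push_cast
    ring

/-- **Hurwitz's theorem**: a holomorphic function on the unit disk that omits `1` and vanishes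
only at the origin has universally bounded derivative there. -/
theorem norm_deriv_zero_le_of_omits_one {f : ℂ → ℂ} (hf : DifferentiableOn ℂ f (ball 0 1))
    (hf0 : f 0 = 0) (hne : ∀ z ∈ ball (0 : ℂ) 1, z ≠ 0 → f z ≠ 0)
    (h1 : ∀ z ∈ ball (0 : ℂ) 1, f z ≠ 1) : ‖deriv f 0‖ ≤ 4000 := by
  have h0 : (0 : ℂ) ∈ ball (0 : ℂ) 1 := mem_ball_self one_pos
  have hpi : (2 * Real.pi * I : ℂ) ≠ 0 := two_pi_I_ne_zero
  obtain ⟨G, hG, hG0, hGe⟩ := exists_holomorphic_log_on_ball (f := fun z => 1 - f z)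
    ((differentiableOn_const 1).sub hf) (fun z hz h => h1 z hz (sub_eq_zero.1 h).symm)
    (l := 0) (by simp [hf0])
  have hGint : ∀ z ∈ ball (0 : ℂ) 1, ∀ n : ℤ, n ≠ 0 → G z / (2 * Real.pi * I) ≠ n := by
    intro z hz n hn h
    rw [div_eq_iff hpi] at h
    have h2 := hGe z hz
    rw [h, exp_int_mul_two_pi_mul_I] at h2
    have hfz : f z = 0 := by linear_combination h2
    have hz0 : z = 0 := by
      by_contra hz0
      exact hne z hz hz0 hfz
    rw [hz0, hG0] at h
    rcases mul_eq_zero.1 h.symm with h | h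
    · exact hn (by exact_mod_cast h)
    · exact hpi h
  set c : ℂ → ℂ := fun z => G z / (2 * Real.pi * I) with hc_def
  have hc : DifferentiableOn ℂ c (ball 0 1) := hG.div_const _
  have hc0 : c 0 = 0 := by simp [hc_def, hG0]
  have hcne : ∀ z ∈ ball (0 : ℂ) 1, 1 - c z ^ 2 ≠ 0 := by
    intro z hz h
    have : (1 - c z) * (1 + c z) = 0 := by linear_combination h
    rcases mul_eq_zero.1 this with h | h
    · exact hGint z hz 1 one_ne_zero (by push_cast; linear_combination -h)
    · exact hGint z hz (-1) (by norm_num) (by push_cast; linear_combination h)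
  obtain ⟨S, hS, hS0, hSe⟩ := exists_holomorphic_log_on_ball (f := fun z => 1 - c z ^ 2)
    ((differentiableOn_const 1).sub (hc.pow 2)) hcne (l := 0) (by simp [hc0])
  set s : ℂ → ℂ := fun z => exp (S z / 2) with hs_def
  have hs : DifferentiableOn ℂ s (ball 0 1) := (hS.div_const 2).cexp
  have hsq : ∀ z ∈ ball (0 : ℂ) 1, s z ^ 2 = 1 - c z ^ 2 := by
    intro z hz
    rw [hs_def, ← hSe z hz]
    simp only
    rw [← exp_nat_mul]
    congr 1
    push_cast
    ring
  have hs0 : s 0 = 1 := by simp [hs_def, hS0]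
  have hprod : ∀ z ∈ ball (0 : ℂ) 1, (c z + I * s z) * (c z - I * s z) = 1 := by
    intro z hz
    linear_combination hsq z hz - (s z) ^ 2 * I_sq
  obtain ⟨L, hL, hL0, hLe⟩ := exists_holomorphic_log_on_ball (f := fun z => c z + I * s z)
    (hc.add ((differentiableOn_const I).mul hs))
    (fun z hz h => by simpa [h] using hprod z hz) (l := Real.pi / 2 * I)
    (by simp [hc0, hs0, exp_pi_div_two_mul_I])
  set H : ℂ → ℂ := fun z => -I * L z with hH_def
  have hH : DifferentiableOn ℂ H (ball 0 1) := (differentiableOn_const (-I)).mul hL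
  have hcos : ∀ z ∈ ball (0 : ℂ) 1, cos (H z) = c z := by
    intro z hz
    have e1 : H z * I = L z := by
      simp only [hH_def]; linear_combination -L z * I_sq
    have e2 : exp (-L z) = c z - I * s z := by
      rw [exp_neg, hLe z hz]
      exact inv_eq_of_mul_eq_one_right (hprod z hz)
    rw [Complex.cos, neg_mul, e1, e2, hLe z hz]
    ring
  have hbloch : ‖deriv H 0‖ ≤ 96 * 4 := by
    refine norm_deriv_le_of_image_contains_no_ball hH fun w => ?_
    obtain ⟨v, hv, n, hn, hvn⟩ := exists_mem_ball_cos_eq_int w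
    refine ⟨v, hv, ?_⟩
    rintro ⟨z, hz, rfl⟩
    exact hGint z hz n hn (by rw [← hvn, hcos z hz])
  have hd : ∀ g : ℂ → ℂ, DifferentiableOn ℂ g (ball 0 1) → HasDerivAt g (deriv g 0) 0 :=
    fun g hg => (hg.differentiableAt (isOpen_ball.mem_nhds h0)).hasDerivAt
  have hev : ∀ᶠ z in nhds (0 : ℂ), z ∈ ball (0 : ℂ) 1 := isOpen_ball.mem_nhds h0
  have hH0 : H 0 = Real.pi / 2 := by
    simp only [hH_def, hL0]; linear_combination (-(Real.pi / 2 : ℂ)) * I_sq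
  have d1 : deriv c 0 = -deriv H 0 := by
    have := (hd H hH).ccos.congr_of_eventuallyEq (hev.mono fun z hz => (hcos z hz).symm)
    rw [this.deriv, hH0, sin_pi_div_two]
    ring
  have d2 : -deriv f 0 = deriv c 0 * (2 * Real.pi * I) := by
    have e1 := ((hd f hf).const_sub 1)
    have e2 := (hd G hG).cexp.congr_of_eventuallyEq (hev.mono fun z hz => (hGe z hz).symm)
    have e3 := e1.unique e2
    rw [e3, hG0, exp_zero, one_mul]
    have : deriv c 0 = deriv G 0 / (2 * Real.pi * I) := ((hd G hG).div_const _).deriv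
    rw [this, div_mul_cancel₀ _ hpi]
  have : ‖deriv f 0‖ = ‖deriv H 0‖ * (2 * Real.pi) := by
    rw [← norm_neg, d2, d1, norm_mul, norm_neg]
    congr 1
    simp [abs_of_pos Real.pi_pos]
  rw [this]
  nlinarith [Real.pi_lt_four, Real.pi_pos, norm_nonneg (deriv H 0)]

/-- Hurwitz's bound for maps of the unit disk omitting an arbitrary point `a`. -/
theorem norm_deriv_zero_le_of_omits {h : ℂ → ℂ} {w a : ℂ}
    (hd : DifferentiableOn ℂ h unitDisk) (h0 : h 0 = w)
    (hne : ∀ t ∈ unitDisk, t ≠ 0 → h t ≠ w) (ha : ∀ t ∈ unitDisk, h t ≠ a) :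
    ‖deriv h 0‖ ≤ 4000 * ‖w - a‖ := by
  have hz : (0 : ℂ) ∈ ball (0 : ℂ) 1 := mem_ball_self one_pos
  have haw : a - w ≠ 0 := sub_ne_zero.2 fun e => ha 0 hz (h0.trans e.symm)
  have key := norm_deriv_zero_le_of_omits_one (f := fun z => (h z - w) / (a - w))
    ((hd.sub_const w).div_const _) (by simp [h0])
    (fun z hz hz0 => div_ne_zero (sub_ne_zero.2 (hne z hz hz0)) haw)
    (fun z hz e => ha z hz (sub_left_injective ((div_eq_one_iff_eq haw).1 e)))
  rw [deriv_div_const, deriv_sub_const, norm_div,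
    div_le_iff₀ (norm_pos_iff.2 haw), norm_sub_rev] at key
  exact key

/-- The admissible derivatives defining the Hurwitz radius contract under admissible maps into
domains omitting a point. -/
theorem mul_norm_deriv_le_of_admissible {Y Ω : Set ℂ} (hYo : IsOpen Y) {s w a : ℂ}
    {h : ℂ → ℂ} (hd : DifferentiableOn ℂ h Y) (hm : MapsTo h Y Ω) (hs : h s = w)
    (hne : ∀ t ∈ Y, t ≠ s → h t ≠ w) (ha : a ∉ Ω) {r : ℝ} (hr : 0 < r) {g : ℂ → ℂ}
    (hg : DifferentiableOn ℂ g unitDisk) (hgm : MapsTo g unitDisk Y) (hg0 : g 0 = s)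
    (hgne : ∀ t ∈ unitDisk, t ≠ 0 → g t ≠ s) (hgd : deriv g 0 = (r : ℂ)) :
    r * ‖deriv h s‖ ≤ 4000 * ‖w - a‖ := by
  have hz : (0 : ℂ) ∈ unitDisk := mem_ball_self one_pos
  have key := norm_deriv_zero_le_of_omits (h := h ∘ g) (w := w) (a := a)
    (hd.comp hg hgm) (by simp [hg0, hs])
    (fun t ht ht0 => hne _ (hgm ht) (hgne t ht ht0))
    (fun t ht e => ha (e ▸ hm (hgm ht)))
  have h1 : HasDerivAt g (r : ℂ) 0 :=
    hgd ▸ (hg.differentiableAt (isOpen_ball.mem_nhds hz)).hasDerivAt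
  have h2 : HasDerivAt h (deriv h s) (g 0) := by
    rw [hg0]
    exact (hd.differentiableAt (hYo.mem_nhds (hg0 ▸ hgm hz))).hasDerivAt
  rw [(h2.comp 0 h1).deriv, norm_mul, norm_real, Real.norm_of_nonneg hr.le, mul_comm] at key
  exact key

theorem bddAbove_hurwitzRadius_set {Y : Set ℂ} (hYo : IsOpen Y) (hYp : Y ≠ univ) (s : ℂ) :
    BddAbove { r : ℝ | 0 < r ∧ ∃ h : ℂ → ℂ, DifferentiableOn ℂ h unitDisk ∧
      MapsTo h unitDisk Y ∧ h 0 = s ∧ (∀ t ∈ unitDisk, t ≠ 0 → h t ≠ s) ∧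
      deriv h 0 = (r : ℂ) } := by
  obtain ⟨b, hb⟩ := (ne_univ_iff_exists_notMem Y).1 hYp
  refine ⟨4000 * ‖s - b‖, ?_⟩
  rintro r ⟨hr, g, hg, hgm, hg0, hgne, hgd⟩
  simpa using mul_norm_deriv_le_of_admissible hYo (h := id) differentiableOn_id (mapsTo_id Y)
    rfl (fun t _ ht => ht) hb hr hg hgm hg0 hgne hgd

theorem hurwitzRadius_pos {Y : Set ℂ} (hYo : IsOpen Y) (hYp : Y ≠ univ) {s : ℂ} (hs : s ∈ Y) :
    0 < hurwitzRadius Y s := by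
  obtain ⟨ε, hε, hball⟩ := Metric.isOpen_iff.1 hYo s hs
  refine hε.trans_le (le_csSup (bddAbove_hurwitzRadius_set hYo hYp s)
    ⟨hε, fun z => s + ε * z, by fun_prop, fun z hz => hball ?_, by simp, ?_, ?_⟩)
  · have hz' : ‖z‖ < 1 := by simpa [unitDisk] using hz
    rw [mem_ball, dist_eq_norm, add_sub_cancel_left, norm_mul, norm_real,
      Real.norm_of_nonneg hε.le]
    nlinarith
  · intro t _ ht
    simp [hε.ne', ht]
  · simp

/-- The generalized Hurwitz density dominates a multiple of the reciprocal of the distance to any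
omitted point. -/
theorem ofReal_le_genHurwitzDensity {Y Ω : Set ℂ} (hYo : IsOpen Y) (hYp : Y ≠ univ) {w a : ℂ}
    (hw : w ∈ Ω) (ha : a ∉ Ω) :
    ENNReal.ofReal (1 / 2000 / ‖w - a‖) ≤ genHurwitzDensity Y Ω w := by
  refine le_sInf ?_
  rintro x ⟨s, hs, h, hd, hm, hsw, hne, hh, rfl⟩
  have hwa : 0 < ‖w - a‖ := norm_pos_iff.2 (sub_ne_zero.2 fun e => ha (e ▸ hw))
  have hh' : 0 < ‖deriv h s‖ := norm_pos_iff.2 hh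
  have hpos := hurwitzRadius_pos hYo hYp hs
  have hle : hurwitzRadius Y s ≤ 4000 * ‖w - a‖ / ‖deriv h s‖ := by
    refine Real.sSup_le ?_ (by positivity)
    rintro r ⟨hr, g, hg, hgm, hg0, hgne, hgd⟩
    rw [le_div_iff₀ hh']
    exact mul_norm_deriv_le_of_admissible hYo hd hm hsw hne ha hr hg hgm hg0 hgne hgd
  rw [le_div_iff₀ hh'] at hle
  refine ENNReal.ofReal_le_ofReal ?_
  rw [hurwitzDensity, div_div, div_div, div_le_div_iff₀ (by positivity) (by positivity)]
  linarith

open MeasureTheory Filter Topology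

/-- The length of the path `γ` on `[a, b]` with respect to the density `ρ`. -/
def densityLength (ρ : ℂ → ℝ≥0∞) (γ : ℝ → ℂ) (a b : ℝ) : ℝ≥0∞ :=
  ∫⁻ t in Icc a b, ρ (γ t) * ENNReal.ofReal ‖derivWithin γ (Icc a b) t‖

/-- The infimum of the `ρ`-lengths of the `C¹` paths in `Ω` joining two points. -/
def densityDist (ρ : ℂ → ℝ≥0∞) (Ω : Set ℂ) (z₁ z₂ : ℂ) : ℝ≥0∞ :=
  sInf { L : ℝ≥0∞ | ∃ γ : ℝ → ℂ, IsPathIn Ω z₁ z₂ γ ∧ L = densityLength ρ γ 0 1 }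

section Length

variable {ρ : ℂ → ℝ≥0∞} {γ γ₁ γ₂ : ℝ → ℂ} {f : ℝ → ℝ} {a b : ℝ}

theorem densityLength_congr (h : EqOn γ₁ γ₂ (Icc a b)) :
    densityLength ρ γ₁ a b = densityLength ρ γ₂ a b :=
  setLIntegral_congr_fun measurableSet_Icc fun t ht => by
    simp only [h ht, derivWithin_congr h (h ht)]

theorem densityLength_const (z : ℂ) : densityLength ρ (fun _ => z) a b = 0 := by
  simp [densityLength]

/-- The length on a subinterval can be computed with the derivative within a larger interval. -/
theorem setLIntegral_derivWithin_Icc_eq {a' b' : ℝ} (ha : a' ≤ a) (hb : b ≤ b') :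
    ∫⁻ t in Icc a b, ρ (γ t) * ENNReal.ofReal ‖derivWithin γ (Icc a' b') t‖ =
      densityLength ρ γ a b := by
  rw [densityLength, ← restrict_Ioo_eq_restrict_Icc]
  refine setLIntegral_congr_fun measurableSet_Ioo fun t ht => ?_
  rw [derivWithin_of_mem_nhds (Icc_mem_nhds ht.1 ht.2),
    derivWithin_of_mem_nhds (Icc_mem_nhds (ha.trans_lt ht.1) (ht.2.trans_le hb))]

theorem densityLength_comp_of_monotoneOn (hab : a ≤ b) (hf : MonotoneOn f (Icc a b))
    (hfd : DifferentiableOn ℝ f (Icc a b)) (hγ : DifferentiableOn ℝ γ (Icc (f a) (f b))) :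
    densityLength ρ (γ ∘ f) a b = densityLength ρ γ (f a) (f b) := by
  have him : f '' Icc a b = Icc (f a) (f b) := hfd.continuousOn.image_Icc_of_monotoneOn hab hf
  rw [densityLength, densityLength, ← him, lintegral_image_eq_lintegral_deriv_mul_of_monotoneOn
    measurableSet_Icc (fun t ht => (hfd t ht).hasDerivWithinAt) hf]
  refine setLIntegral_congr_fun measurableSet_Icc fun t ht => ?_
  rw [← him] at hγ
  rw [derivWithin.scomp t (hγ _ (mem_image_of_mem f ht)) (hfd t ht)
    (mapsTo_image f _), norm_smul, ENNReal.ofReal_mul (norm_nonneg _),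
    Real.norm_of_nonneg hf.derivWithin_nonneg, Function.comp_apply]
  ring

theorem densityLength_comp_of_antitoneOn (hab : a ≤ b) (hf : AntitoneOn f (Icc a b))
    (hfd : DifferentiableOn ℝ f (Icc a b)) (hγ : DifferentiableOn ℝ γ (Icc (f b) (f a))) :
    densityLength ρ (γ ∘ f) a b = densityLength ρ γ (f b) (f a) := by
  have him : f '' Icc a b = Icc (f b) (f a) := hfd.continuousOn.image_Icc_of_antitoneOn hab hf
  rw [densityLength, densityLength, ← him, lintegral_image_eq_lintegral_deriv_mul_of_antitoneOn
    measurableSet_Icc (fun t ht => (hfd t ht).hasDerivWithinAt) hf]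
  refine setLIntegral_congr_fun measurableSet_Icc fun t ht => ?_
  rw [← him] at hγ
  rw [derivWithin.scomp t (hγ _ (mem_image_of_mem f ht)) (hfd t ht)
    (mapsTo_image f _), norm_smul, ENNReal.ofReal_mul (norm_nonneg _),
    Real.norm_of_nonpos hf.derivWithin_nonpos, Function.comp_apply]
  ring

end Length

theorem IsPathIn.densityDist_le {Ω : Set ℂ} {z₁ z₂ : ℂ} {γ : ℝ → ℂ} (ρ : ℂ → ℝ≥0∞)
    (h : IsPathIn Ω z₁ z₂ γ) : densityDist ρ Ω z₁ z₂ ≤ densityLength ρ γ 0 1 :=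
  sInf_le ⟨γ, h, rfl⟩

theorem exists_isPathIn_of_densityDist_lt {Ω : Set ℂ} {z₁ z₂ : ℂ} {ρ : ℂ → ℝ≥0∞} {ε : ℝ≥0∞}
    (h : densityDist ρ Ω z₁ z₂ < ε) :
    ∃ γ : ℝ → ℂ, IsPathIn Ω z₁ z₂ γ ∧ densityLength ρ γ 0 1 < ε := by
  obtain ⟨_, ⟨γ, hγ, rfl⟩, hlt⟩ := sInf_lt_iff.1 h
  exact ⟨γ, hγ, hlt⟩

theorem densityDist_symm_le (ρ : ℂ → ℝ≥0∞) (Ω : Set ℂ) (z₁ z₂ : ℂ) :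
    densityDist ρ Ω z₂ z₁ ≤ densityDist ρ Ω z₁ z₂ := by
  refine le_sInf ?_
  rintro _ ⟨γ, ⟨h0, h1, hm, hc⟩, rfl⟩
  have hmaps : MapsTo (fun t : ℝ => 1 - t) (Icc 0 1) (Icc 0 1) := fun t ht =>
    ⟨by linarith [ht.2], by linarith [ht.1]⟩
  have hrev : IsPathIn Ω z₂ z₁ (γ ∘ fun t => 1 - t) :=
    ⟨by simp [h1], by simp [h0], fun t ht => hm _ (hmaps ht),
      hc.comp (by fun_prop) hmaps⟩
  refine (hrev.densityDist_le ρ).trans_eq ?_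
  have := densityLength_comp_of_antitoneOn (ρ := ρ) (γ := γ) (f := fun t : ℝ => 1 - t)
    zero_le_one (fun x _ y _ hxy => by simp only; linarith) (by fun_prop)
    (by simpa using hc.differentiableOn one_ne_zero)
  simpa using this

/-- Any `C¹` path can be reparametrized to have speed at most twice a given upper bound for its
Euclidean length. -/
theorem IsPathIn.exists_reparam {Ω : Set ℂ} {z₁ z₂ : ℂ} {P : ℝ → ℂ} (hP : IsPathIn Ω z₁ z₂ P)
    {l : ℝ} (hl : 0 < l) (hlen : densityLength (fun _ => 1) P 0 1 ≤ ENNReal.ofReal l)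
    (ρ : ℂ → ℝ≥0∞) :
    ∃ Q : ℝ → ℂ, IsPathIn Ω z₁ z₂ Q ∧ densityLength ρ Q 0 1 = densityLength ρ P 0 1 ∧
      ∀ t ∈ Icc (0 : ℝ) 1, ‖derivWithin Q (Icc 0 1) t‖ ≤ 2 * l := by
  obtain ⟨h0, h1, hm, hc⟩ := hP
  have hdc : ContinuousOn (fun t => ‖derivWithin P (Icc 0 1) t‖) (Icc 0 1) :=
    (hc.continuousOn_derivWithin (uniqueDiffOn_Icc one_pos) le_rfl).norm
  set v : ℝ → ℝ := IccExtend zero_le_one (domRestrict (Icc 0 1)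
    fun t => ‖derivWithin P (Icc 0 1) t‖) with hv_def
  have hv : Continuous v := (continuousOn_iff_continuous_domRestrict.1 hdc).Icc_extend'
  have hv0 : ∀ t, 0 ≤ v t := fun t => norm_nonneg _
  have hveq : ∀ t ∈ Icc (0 : ℝ) 1, v t = ‖derivWithin P (Icc 0 1) t‖ := fun t ht => by
    rw [hv_def, IccExtend_of_mem _ _ ht]
    rfl
  set A : ℝ → ℝ := fun t => ∫ s in (0 : ℝ)..t, (v s + l) with hA_def
  have hvl : Continuous fun s => v s + l := hv.add continuous_const
  have hA : ∀ t, HasDerivAt A (v t + l) t := fun t =>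
    intervalIntegral.integral_hasDerivAt_right (hvl.intervalIntegrable _ _)
      (hvl.stronglyMeasurableAtFilter _ _) hvl.continuousAt
  have hA0 : A 0 = 0 := by simp [hA_def]
  have hApos : ∀ t, 0 < v t + l := fun t => add_pos_of_nonneg_of_pos (hv0 t) hl
  have hAmono : StrictMono A := strictMono_of_deriv_pos fun t => by
    rw [(hA t).deriv]
    exact hApos t
  have hAcont : Continuous A := continuous_iff_continuousAt.2 fun t => (hA t).continuousAt
  have hA1 : A 1 ≤ 2 * l := by
    have e1 : A 1 = (∫ s in (0 : ℝ)..1, v s) + l := by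
      simp only [hA_def]
      rw [intervalIntegral.integral_add (hv.intervalIntegrable _ _) (by simp)]
      simp
    have e2 : ∫ s in (0 : ℝ)..1, v s ≤ l := by
      rw [intervalIntegral.integral_of_le zero_le_one, ← integral_Icc_eq_integral_Ioc,
        integral_eq_lintegral_of_nonneg_ae (Eventually.of_forall hv0)
          hv.aestronglyMeasurable]
      refine ENNReal.toReal_le_of_le_ofReal hl.le (le_trans (le_of_eq ?_) hlen)
      refine setLIntegral_congr_fun measurableSet_Icc fun t ht => ?_
      simp only [one_mul, hveq t ht]
    linarith
  have hA1pos : 0 < A 1 := hA0 ▸ hAmono one_pos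
  have hgrow : ∀ x y, x ≤ y → l * (y - x) ≤ A y - A x := by
    intro x y hxy
    refine (convex_univ (𝕜 := ℝ) (E := ℝ)).mul_sub_le_image_sub_of_le_deriv
      hAcont.continuousOn
      (fun t _ => (hA t).differentiableAt.differentiableWithinAt) (fun t _ => ?_) x trivial y
      trivial hxy
    rw [(hA t).deriv]
    linarith [hv0 t]
  have hsurj : Function.Surjective A := by
    refine hAcont.surjective ?_ ?_
    · refine tendsto_atTop_mono' _ ?_ (tendsto_id.const_mul_atTop hl)
      filter_upwards [eventually_ge_atTop 0] with t ht
      have := hgrow 0 t ht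
      simp only [id]
      linarith
    · refine tendsto_atBot_mono' _ ?_ (tendsto_id.const_mul_atBot hl)
      filter_upwards [eventually_le_atBot 0] with t ht
      have := hgrow t 0 ht
      simp only [id]
      linarith
  set e : ℝ ≃o ℝ := hAmono.orderIsoOfSurjective A hsurj with he_def
  set σ : ℝ → ℝ := fun x => e.symm x with hσ_def
  have hAσ : ∀ x, A (σ x) = x := fun x => e.apply_symm_apply x
  have hσA : ∀ x, σ (A x) = x := fun x => e.symm_apply_apply x
  have hσc : Continuous σ := e.symm.continuous
  have hσd : ∀ x, HasDerivAt σ (v (σ x) + l)⁻¹ x := fun x =>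
    HasDerivAt.of_local_left_inverse hσc.continuousAt (hA (σ x)) (hApos _).ne'
      (Eventually.of_forall hAσ)
  set τ : ℝ → ℝ := fun t => σ (A 1 * t) with hτ_def
  have hτd : ∀ x, HasDerivAt τ ((v (τ x) + l)⁻¹ * A 1) x := fun x => by
    have := (hσd (A 1 * x)).comp x ((hasDerivAt_id x).const_mul (A 1))
    rw [mul_one] at this
    exact this
  have hτ0 : τ 0 = 0 := by
    have := hσA 0
    rw [hA0] at this
    simpa [hτ_def] using this
  have hτ1 : τ 1 = 1 := by simpa [hτ_def] using hσA 1
  have hτm : Monotone τ := fun x y hxy =>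
    e.symm.monotone (mul_le_mul_of_nonneg_left hxy hA1pos.le)
  have hτdiff : Differentiable ℝ τ := fun x => (hτd x).differentiableAt
  have hτC : ContDiff ℝ 1 τ := by
    rw [contDiff_one_iff_deriv]
    refine ⟨hτdiff, ?_⟩
    have : deriv τ = fun x => (v (τ x) + l)⁻¹ * A 1 := funext fun x => (hτd x).deriv
    rw [this]
    exact ((hvl.comp hτdiff.continuous).inv₀ fun x => (hApos _).ne').mul continuous_const
  have hτmaps : MapsTo τ (Icc 0 1) (Icc 0 1) := fun t ht =>
    ⟨hτ0 ▸ hτm ht.1, hτ1 ▸ hτm ht.2⟩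
  refine ⟨P ∘ τ, ⟨by simp [hτ0, h0], by simp [hτ1, h1], fun t ht => hm _ (hτmaps ht),
    hc.comp hτC.contDiffOn hτmaps⟩, ?_, fun t ht => ?_⟩
  · have := densityLength_comp_of_monotoneOn (ρ := ρ) (γ := P) (f := τ) zero_le_one
      (hτm.monotoneOn _) hτdiff.differentiableOn
      (by rw [hτ0, hτ1]; exact hc.differentiableOn one_ne_zero)
    rwa [hτ0, hτ1] at this
  · rw [derivWithin.scomp t (hc.differentiableOn one_ne_zero _ (hτmaps ht))
      (hτdiff t).differentiableWithinAt hτmaps, norm_smul,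
      (hτd t).hasDerivWithinAt.derivWithin (uniqueDiffOn_Icc one_pos t ht),
      ← hveq _ (hτmaps ht), norm_mul, Real.norm_of_nonneg hA1pos.le,
      Real.norm_of_nonneg (inv_nonneg.2 (hApos _).le)]
    calc (v (τ t) + l)⁻¹ * A 1 * v (τ t) = A 1 * (v (τ t) / (v (τ t) + l)) := by ring
      _ ≤ A 1 * 1 := by
        gcongr
        exact div_le_one_of_le₀ (by linarith) (hApos _).le
      _ ≤ 2 * l := by linarith

theorem exists_norm_deriv_smoothTransition_le :
    ∃ B : ℝ, 0 ≤ B ∧ ∀ x, ‖deriv Real.smoothTransition x‖ ≤ B := by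
  have hcont : Continuous (deriv Real.smoothTransition) :=
    (Real.smoothTransition.contDiff (n := 1)).continuous_deriv le_rfl
  obtain ⟨B, hB⟩ := (isCompact_Icc (a := (0 : ℝ)) (b := 1)).exists_bound_of_continuousOn
    hcont.continuousOn
  have hB0 : 0 ≤ B := (norm_nonneg _).trans (hB 0 ⟨le_rfl, zero_le_one⟩)
  refine ⟨B, hB0, fun x => ?_⟩
  rcases lt_or_ge x 0 with hx | hx
  · have : Real.smoothTransition =ᶠ[𝓝 x] fun _ => 0 :=
      (eventually_lt_nhds hx).mono fun y hy => Real.smoothTransition.zero_of_nonpos hy.le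
    rw [this.deriv_eq]
    simpa using hB0
  rcases lt_or_ge 1 x with hx1 | hx1
  · have : Real.smoothTransition =ᶠ[𝓝 x] fun _ => 1 :=
      (eventually_gt_nhds hx1).mono fun y hy => Real.smoothTransition.one_of_one_le hy.le
    rw [this.deriv_eq]
    simpa using hB0
  exact hB x ⟨hx, hx1⟩

/-- A smooth monotone map from `[1 - 2⁻ᵏ, 1 - 2⁻ᵏ⁻¹]` onto `[0, 1]`, constant outside. -/
def dyadicTransition (k : ℕ) (t : ℝ) : ℝ :=
  Real.smoothTransition (2 ^ (k + 1) * (t - (1 - (1 / 2) ^ k)))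

theorem dyadicTransition_mem_Icc (k : ℕ) (t : ℝ) : dyadicTransition k t ∈ Icc (0 : ℝ) 1 :=
  ⟨Real.smoothTransition.nonneg _, Real.smoothTransition.le_one _⟩

theorem dyadicTransition_contDiff (k : ℕ) : ContDiff ℝ 1 (dyadicTransition k) :=
  Real.smoothTransition.contDiff.comp (by fun_prop)

theorem dyadicTransition_monotone (k : ℕ) : Monotone (dyadicTransition k) := fun x y hxy =>
  Real.smoothTransition.monotone (by gcongr)

theorem dyadicTransition_of_le {k : ℕ} {t : ℝ} (ht : t ≤ 1 - (1 / 2) ^ k) :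
    dyadicTransition k t = 0 :=
  Real.smoothTransition.zero_of_nonpos
    (mul_nonpos_of_nonneg_of_nonpos (by positivity) (by linarith))

theorem dyadicTransition_of_ge {k : ℕ} {t : ℝ} (ht : 1 - (1 / 2) ^ (k + 1) ≤ t) :
    dyadicTransition k t = 1 := by
  refine Real.smoothTransition.one_of_one_le ?_
  have h1 : (2 : ℝ) ^ (k + 1) * (1 / 2) ^ (k + 1) = 1 := by
    rw [← mul_pow]
    norm_num
  have h2 : (1 / 2 : ℝ) ^ (k + 1) ≤ t - (1 - (1 / 2) ^ k) := by
    rw [pow_succ] at ht ⊢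
    linarith
  calc (1 : ℝ) = 2 ^ (k + 1) * (1 / 2) ^ (k + 1) := h1.symm
    _ ≤ _ := by gcongr

theorem norm_deriv_dyadicTransition_le {B : ℝ}
    (hB : ∀ x, ‖deriv Real.smoothTransition x‖ ≤ B) (k : ℕ) (t : ℝ) :
    ‖deriv (dyadicTransition k) t‖ ≤ B * 2 ^ (k + 1) := by
  have h1 : HasDerivAt (fun t : ℝ => 2 ^ (k + 1) * (t - (1 - (1 / 2) ^ k))) (2 ^ (k + 1)) t := by
    simpa using ((hasDerivAt_id t).sub_const (1 - (1 / 2) ^ k : ℝ)).const_mul (2 ^ (k + 1) : ℝ)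
  have h2 : HasDerivAt Real.smoothTransition _ (2 ^ (k + 1) * (t - (1 - (1 / 2) ^ k))) :=
    ((Real.smoothTransition.contDiff (n := 1)).differentiable one_ne_zero _).hasDerivAt
  have h3 : HasDerivAt (dyadicTransition k) _ t := h2.comp t h1
  rw [h3.deriv, norm_mul, Real.norm_of_nonneg (by positivity : (0 : ℝ) ≤ 2 ^ (k + 1))]
  gcongr
  exact hB _

/-- Infinite concatenation: countably many `C¹` paths, run faster and faster but with rapidly
decaying speed, join the initial point of the first path to the limit of the endpoints. -/
theorem densityDist_le_tsum {ρ : ℂ → ℝ≥0∞} {Ω : Set ℂ} {u : ℕ → ℂ} {w : ℂ} {P : ℕ → ℝ → ℂ}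
    {M : ℕ → ℝ} (hP : ∀ k, IsPathIn Ω (u k) (u (k + 1)) (P k))
    (hM : ∀ k, ∀ t ∈ Icc (0 : ℝ) 1, ‖derivWithin (P k) (Icc 0 1) t‖ ≤ M k)
    (hsum : Summable fun k => 2 ^ k * M k) (hu : Tendsto u atTop (𝓝 w)) (hw : w ∈ Ω) :
    densityDist ρ Ω (u 0) w ≤ ∑' k, densityLength ρ (P k) 0 1 := by
  obtain ⟨B, hB0, hB⟩ := exists_norm_deriv_smoothTransition_le
  have hM0 : ∀ k, 0 ≤ M k := fun k => (norm_nonneg _).trans (hM k 0 ⟨le_rfl, zero_le_one⟩)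
  have hMsum : Summable M := hsum.of_nonneg_of_le hM0 fun k =>
    le_mul_of_one_le_left (hM0 k) (one_le_pow₀ one_le_two)
  have hPd : ∀ k, DifferentiableOn ℝ (P k) (Icc 0 1) := fun k =>
    (hP k).2.2.2.differentiableOn one_ne_zero
  set Q : ℕ → ℝ → ℂ := fun k => P k ∘ dyadicTransition k with hQ_def
  have hQC : ∀ k, ContDiff ℝ 1 (Q k) := fun k =>
    (hP k).2.2.2.comp_contDiff (dyadicTransition_contDiff k) (dyadicTransition_mem_Icc k)
  have hQ0 : ∀ k t, t ≤ 1 - (1 / 2) ^ k → Q k t = u k := fun k t ht => by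
    simp [hQ_def, dyadicTransition_of_le ht, (hP k).1]
  have hQ1 : ∀ k t, 1 - (1 / 2) ^ (k + 1) ≤ t → Q k t = u (k + 1) := fun k t ht => by
    simp only [hQ_def, Function.comp_apply, dyadicTransition_of_ge ht, (hP k).2.1]
  have hQd : ∀ k t, ‖deriv (Q k) t‖ ≤ 2 * B * (2 ^ k * M k) := by
    intro k t
    have hmem := dyadicTransition_mem_Icc k t
    have h1 := ((dyadicTransition_contDiff k).differentiable one_ne_zero t).hasDerivAt
    have h2 := (hPd k _ hmem).hasDerivWithinAt.scomp_of_eq t (h1.hasDerivWithinAt (s := univ))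
      (fun s _ => dyadicTransition_mem_Icc k s) rfl
    rw [(hasDerivWithinAt_univ.1 h2).deriv, norm_smul]
    calc ‖deriv (dyadicTransition k) t‖ * ‖derivWithin (P k) (Icc 0 1) (dyadicTransition k t)‖
        ≤ (B * 2 ^ (k + 1)) * M k := by
          gcongr
          · exact norm_deriv_dyadicTransition_le hB k t
          · exact hM k _ hmem
      _ = 2 * B * (2 ^ k * M k) := by ring
  have hQu : ∀ k t, ‖Q k t - u k‖ ≤ M k := by
    intro k t
    have hmem := dyadicTransition_mem_Icc k t
    have := (convex_Icc (0 : ℝ) 1).norm_image_sub_le_of_norm_hasDerivWithin_le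
      (fun x hx => (hPd k x hx).hasDerivWithinAt) (hM k) ⟨le_rfl, zero_le_one⟩ hmem
    rw [(hP k).1, sub_zero, Real.norm_of_nonneg hmem.1] at this
    exact this.trans (mul_le_of_le_one_right (hM0 k) hmem.2)
  set γ : ℝ → ℂ := fun t => u 0 + ∑' k, (Q k t - u k) with hγ_def
  have hγC : ContDiff ℝ 1 γ := by
    refine contDiff_const.add ?_
    refine contDiff_tsum (N := 1) (v := fun i k => if i = 0 then M k else 2 * B * (2 ^ k * M k))
      (fun k => (hQC k).sub contDiff_const) (fun i _ => ?_) (fun i k t hi => ?_)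
    · by_cases h : i = 0
      · simpa [h] using hMsum
      · simpa [h] using hsum.mul_left (2 * B)
    · have hi' : i ≤ 1 := by exact_mod_cast hi
      interval_cases i
      · simpa using hQu k t
      · rw [norm_iteratedFDeriv_eq_norm_iteratedDeriv, iteratedDeriv_one, deriv_sub_const]
        simpa using hQd k t
  have hpow : ∀ {i j : ℕ}, i ≤ j → (1 / 2 : ℝ) ^ j ≤ (1 / 2) ^ i := fun hij =>
    pow_le_pow_of_le_one (by norm_num) (by norm_num) hij
  have hγQ : ∀ k, EqOn γ (Q k) (Icc (1 - (1 / 2) ^ k) (1 - (1 / 2) ^ (k + 1))) := by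
    intro k t ht
    simp only [hγ_def]
    rw [tsum_eq_sum (s := Finset.range (k + 1)), Finset.sum_range_succ,
      Finset.sum_congr rfl (g := fun j => u (j + 1) - u j), Finset.sum_range_sub]
    · ring
    · intro j hj
      rw [hQ1 j t]
      have : (1 / 2 : ℝ) ^ k ≤ (1 / 2) ^ (j + 1) := hpow (Finset.mem_range.1 hj)
      linarith [ht.1]
    · intro j hj
      rw [hQ0 j t, sub_self]
      have : k + 1 ≤ j := by simpa using hj
      linarith [ht.2, hpow this]
  have hγ1 : γ 1 = w := by
    have hterm : ∀ k, Q k 1 - u k = u (k + 1) - u k := fun k => by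
      rw [hQ1 k 1]
      linarith [pow_pos (by norm_num : (0 : ℝ) < 1 / 2) (k + 1)]
    have hs : Summable fun k => u (k + 1) - u k :=
      hMsum.of_norm_bounded fun k => hterm k ▸ hQu k 1
    have h1 := hs.hasSum.tendsto_sum_nat
    simp only [Finset.sum_range_sub] at h1
    have h2 := tendsto_nhds_unique h1 (hu.sub_const (u 0))
    simp only [hγ_def, hterm, h2]
    ring
  have hγ0 : γ 0 = u 0 := by
    rw [hγQ 0 ⟨by norm_num, by norm_num⟩, hQ0 0 0 (by norm_num)]
  have hcover : Ico (0 : ℝ) 1 ⊆ ⋃ k : ℕ, Icc (1 - (1 / 2 : ℝ) ^ k) (1 - (1 / 2) ^ (k + 1)) := by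
    intro t ht
    obtain ⟨k, hk1, hk2⟩ := exists_nat_pow_near_of_lt_one (x := 1 - t) (y := 1 / 2)
      (by linarith [ht.2]) (by linarith [ht.1]) (by norm_num) (by norm_num)
    exact mem_iUnion.2 ⟨k, by linarith, by linarith⟩
  have hpath : IsPathIn Ω (u 0) w γ := by
    refine ⟨hγ0, hγ1, fun t ht => ?_, hγC.contDiffOn⟩
    rcases ht.2.eq_or_lt with rfl | ht1
    · rwa [hγ1]
    · obtain ⟨k, hk⟩ := mem_iUnion.1 (hcover ⟨ht.1, ht1⟩)
      rw [hγQ k hk]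
      exact (hP k).2.2.1 _ (dyadicTransition_mem_Icc k t)
  refine (hpath.densityDist_le ρ).trans ?_
  rw [densityLength, ← restrict_Ico_eq_restrict_Icc]
  refine (lintegral_mono_set hcover).trans ((lintegral_iUnion_le _ _).trans ?_)
  refine ENNReal.tsum_le_tsum fun k => le_of_eq ?_
  have hkk : (1 - (1 / 2 : ℝ) ^ k) ≤ 1 - (1 / 2) ^ (k + 1) := by
    have : (1 / 2 : ℝ) ^ (k + 1) ≤ (1 / 2) ^ k := hpow (Nat.le_succ k)
    linarith
  have hk0 : (0 : ℝ) ≤ 1 - (1 / 2) ^ k := by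
    have := hpow (Nat.zero_le k)
    rw [pow_zero] at this
    linarith
  have hk1 : (1 - (1 / 2 : ℝ) ^ (k + 1)) ≤ 1 := by
    linarith [pow_pos (by norm_num : (0 : ℝ) < 1 / 2) (k + 1)]
  rw [setLIntegral_derivWithin_Icc_eq hk0 hk1, densityLength_congr (hγQ k)]
  have := densityLength_comp_of_monotoneOn (ρ := ρ) (γ := P k) (f := dyadicTransition k) hkk
    ((dyadicTransition_monotone k).monotoneOn _)
    ((dyadicTransition_contDiff k).differentiable one_ne_zero).differentiableOn
    (by rw [dyadicTransition_of_le le_rfl, dyadicTransition_of_ge le_rfl]; exact hPd k)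
  rwa [dyadicTransition_of_le le_rfl, dyadicTransition_of_ge le_rfl] at this

theorem IsPathIn.exists_norm_derivWithin_le {Ω : Set ℂ} {z₁ z₂ : ℂ} {γ : ℝ → ℂ}
    (h : IsPathIn Ω z₁ z₂ γ) :
    ∃ M : ℝ, ∀ t ∈ Icc (0 : ℝ) 1, ‖derivWithin γ (Icc 0 1) t‖ ≤ M :=
  isCompact_Icc.exists_bound_of_continuousOn
    (h.2.2.2.continuousOn_derivWithin (uniqueDiffOn_Icc one_pos) le_rfl)

theorem densityDist_triangle (ρ : ℂ → ℝ≥0∞) {Ω : Set ℂ} {z₁ z₂ z₃ : ℂ} (hz : z₃ ∈ Ω) :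
    densityDist ρ Ω z₁ z₃ ≤ densityDist ρ Ω z₁ z₂ + densityDist ρ Ω z₂ z₃ := by
  have key : ∀ γ₁ γ₂, IsPathIn Ω z₁ z₂ γ₁ → IsPathIn Ω z₂ z₃ γ₂ →
      densityDist ρ Ω z₁ z₃ ≤ densityLength ρ γ₁ 0 1 + densityLength ρ γ₂ 0 1 := by
    intro γ₁ γ₂ h₁ h₂
    obtain ⟨M₁, hM₁⟩ := h₁.exists_norm_derivWithin_le
    obtain ⟨M₂, hM₂⟩ := h₂.exists_norm_derivWithin_le
    let u : ℕ → ℂ := fun k => if k = 0 then z₁ else if k = 1 then z₂ else z₃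
    let P : ℕ → ℝ → ℂ := fun k => if k = 0 then γ₁ else if k = 1 then γ₂ else fun _ => z₃
    let M : ℕ → ℝ := fun k => if k = 0 then M₁ else if k = 1 then M₂ else 0
    have hconst : IsPathIn Ω z₃ z₃ fun _ => z₃ := ⟨rfl, rfl, fun _ _ => hz, contDiffOn_const⟩
    have hP : ∀ k, IsPathIn Ω (u k) (u (k + 1)) (P k) := by
      rintro (_ | _ | k)
      · simpa [u, P] using h₁
      · simpa [u, P] using h₂
      · simpa [u, P] using hconst
    have hM : ∀ k, ∀ t ∈ Icc (0 : ℝ) 1, ‖derivWithin (P k) (Icc 0 1) t‖ ≤ M k := by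
      rintro (_ | _ | k) t ht
      · simpa [M, P] using hM₁ t ht
      · simpa [M, P] using hM₂ t ht
      · simp [M, P]
    have hvan : ∀ k ∉ Finset.range 2, k ≠ 0 ∧ k ≠ 1 := fun k hk => by
      rw [Finset.mem_range] at hk
      omega
    have hsum : Summable fun k => 2 ^ k * M k :=
      summable_of_ne_finset_zero (s := Finset.range 2) fun k hk => by simp [M, hvan k hk]
    have hu : Tendsto u atTop (𝓝 z₃) := by
      refine tendsto_const_nhds.congr' ?_
      filter_upwards [eventually_ge_atTop 2] with k hk
      have h0 : k ≠ 0 := by omega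
      have h1 : k ≠ 1 := by omega
      simp [u, h0, h1]
    refine (densityDist_le_tsum hP hM hsum hu hz).trans_eq ?_
    rw [tsum_eq_sum (s := Finset.range 2) fun k hk => by
      simp [P, hvan k hk, densityLength_const]]
    simp [Finset.sum_range_succ, P]
  rw [densityDist, densityDist, densityDist, ENNReal.sInf_add]
  refine le_iInf₂ ?_
  rintro _ ⟨γ₁, h₁, rfl⟩
  rw [add_comm, ENNReal.sInf_add]
  refine le_iInf₂ ?_
  rintro _ ⟨γ₂, h₂, rfl⟩
  rw [add_comm]
  exact key γ₁ γ₂ h₁ h₂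

section Complete

variable {ρ : ℂ → ℝ≥0∞} {Ω : Set ℂ} {a z₁ z₂ : ℂ} {γ : ℝ → ℂ} {c : ℝ}

/-- A density bounded below by a multiple of the reciprocal of the distance to an omitted point
controls the variation of `log (‖z - p‖² + D²)` along paths. -/
theorem IsPathIn.ofReal_abs_log_sub_log_le (hγ : IsPathIn Ω z₁ z₂ γ) (hc : 0 ≤ c) (ha : a ∉ Ω)
    (hρ : ∀ w ∈ Ω, ENNReal.ofReal (c / ‖w - a‖) ≤ ρ w) {p : ℂ} {D : ℝ} (hD : ‖p - a‖ ≤ D)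
    {t : ℝ} (ht : t ∈ Icc (0 : ℝ) 1) :
    ENNReal.ofReal (c / 4 * |Real.log (‖γ t - p‖ ^ 2 + D ^ 2) -
      Real.log (‖z₁ - p‖ ^ 2 + D ^ 2)|) ≤ densityLength ρ γ 0 1 := by
  obtain ⟨h0, -, hm, hC⟩ := hγ
  have hr : ∀ z, ‖z - a‖ ≤ ‖z - p‖ + D := fun z =>
    (norm_sub_le_norm_sub_add_norm_sub z p a).trans (by gcongr)
  have hra : ∀ z ∈ Ω, 0 < ‖z - a‖ := fun z hz =>
    norm_pos_iff.2 (sub_ne_zero.2 (ne_of_mem_of_not_mem hz ha))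
  have hpos : ∀ z ∈ Ω, 0 < ‖z - p‖ ^ 2 + D ^ 2 := fun z hz => by
    have := (hra z hz).trans_le (hr z)
    nlinarith [sq_nonneg (‖z - p‖ - D)]
  have hsub : Icc 0 t ⊆ Icc (0 : ℝ) 1 := Icc_subset_Icc_right ht.2
  set f : ℝ → ℝ := fun s => Real.log (‖γ s - p‖ ^ 2 + D ^ 2) with hf_def
  have hf : ContDiffOn ℝ 1 f (Icc 0 t) :=
    ((((hC.mono hsub).sub contDiffOn_const).norm_sq ℝ).add contDiffOn_const).log
      fun s hs => (hpos _ (hm s (hsub hs))).ne'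
  have hft := enorm_sub_le_lintegral_deriv_of_contDiffOn_Icc hf ht.1
  have hpt : ∀ s ∈ Ioo 0 t, ENNReal.ofReal (c / 4) * ‖deriv f s‖ₑ ≤
      ρ (γ s) * ENNReal.ofReal ‖derivWithin γ (Icc 0 1) s‖ := by
    intro s hs
    have hs1 : s ∈ Ioo (0 : ℝ) 1 := ⟨hs.1, hs.2.trans_le ht.2⟩
    have hsm := hm s (Ioo_subset_Icc_self hs1)
    have hnhds := Icc_mem_nhds hs1.1 hs1.2
    have hd : HasDerivAt γ (deriv γ s) s :=
      ((hC.differentiableOn one_ne_zero).differentiableAt hnhds).hasDerivAt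
    have hfd := ((hd.sub_const p).norm_sq.add_const (D ^ 2)).log (hpos _ hsm).ne'
    have hfs : deriv f s = _ := hfd.deriv
    rw [derivWithin_of_mem_nhds hnhds]
    refine le_trans ?_ (mul_le_mul_left (hρ _ hsm) _)
    rw [← ofReal_norm, ← ENNReal.ofReal_mul (by positivity),
      ← ENNReal.ofReal_mul (by positivity)]
    refine ENNReal.ofReal_le_ofReal ?_
    rw [hfs, norm_div, norm_mul, Real.norm_of_nonneg (hpos _ hsm).le, Real.norm_ofNat]
    have hin := norm_inner_le_norm (𝕜 := ℝ) (γ s - p) (deriv γ s)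
    have key : 2 * ‖γ s - p‖ / (‖γ s - p‖ ^ 2 + D ^ 2) ≤ 4 / ‖γ s - a‖ := by
      rw [div_le_div_iff₀ (hpos _ hsm) (hra _ hsm)]
      nlinarith [mul_le_mul_of_nonneg_left (hr (γ s)) (norm_nonneg (γ s - p)),
        sq_nonneg (‖γ s - p‖ - D), sq_nonneg D]
    calc c / 4 * (2 * ‖inner ℝ (γ s - p) (deriv γ s)‖ / (‖γ s - p‖ ^ 2 + D ^ 2))
        ≤ c / 4 * (2 * (‖γ s - p‖ * ‖deriv γ s‖) / (‖γ s - p‖ ^ 2 + D ^ 2)) := by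
          have := (hpos _ hsm).le
          gcongr
      _ = c / 4 * (2 * ‖γ s - p‖ / (‖γ s - p‖ ^ 2 + D ^ 2)) * ‖deriv γ s‖ := by ring
      _ ≤ c / 4 * (4 / ‖γ s - a‖) * ‖deriv γ s‖ := by gcongr
      _ = c / ‖γ s - a‖ * ‖deriv γ s‖ := by ring
  rw [ENNReal.ofReal_mul (by positivity), ← Real.norm_eq_abs, ofReal_norm, ← h0]
  calc ENNReal.ofReal (c / 4) * ‖f t - f 0‖ₑ
      ≤ ENNReal.ofReal (c / 4) * ∫⁻ s in Ioo 0 t, ‖deriv f s‖ₑ := by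
        rw [restrict_Ioo_eq_restrict_Icc]
        gcongr
    _ = ∫⁻ s in Ioo 0 t, ENNReal.ofReal (c / 4) * ‖deriv f s‖ₑ :=
        (lintegral_const_mul' _ _ ENNReal.ofReal_ne_top).symm
    _ ≤ ∫⁻ s in Ioo 0 t, ρ (γ s) * ENNReal.ofReal ‖derivWithin γ (Icc 0 1) s‖ :=
        setLIntegral_mono' measurableSet_Ioo hpt
    _ ≤ densityLength ρ γ 0 1 := lintegral_mono_set (Ioo_subset_Icc_self.trans hsub)

theorem densityDist_pos (hc : 0 < c) (ha : a ∉ Ω)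
    (hρ : ∀ w ∈ Ω, ENNReal.ofReal (c / ‖w - a‖) ≤ ρ w) (hz₁ : z₁ ∈ Ω) (hne : z₁ ≠ z₂) :
    0 < densityDist ρ Ω z₁ z₂ := by
  have hD : 0 < ‖z₁ - a‖ := norm_pos_iff.2 (sub_ne_zero.2 (ne_of_mem_of_not_mem hz₁ ha))
  have hR : 0 < ‖z₂ - z₁‖ := norm_pos_iff.2 (sub_ne_zero.2 hne.symm)
  have hlog : Real.log (‖z₁ - z₁‖ ^ 2 + ‖z₁ - a‖ ^ 2) <
      Real.log (‖z₂ - z₁‖ ^ 2 + ‖z₁ - a‖ ^ 2) := by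
    refine Real.log_lt_log (by positivity) ?_
    rw [sub_self, norm_zero]
    gcongr
  have hlow : 0 < ENNReal.ofReal (c / 4 * |Real.log (‖z₂ - z₁‖ ^ 2 + ‖z₁ - a‖ ^ 2) -
      Real.log (‖z₁ - z₁‖ ^ 2 + ‖z₁ - a‖ ^ 2)|) :=
    ENNReal.ofReal_pos.2 (mul_pos (by positivity) (abs_pos.2 (sub_pos.2 hlog).ne'))
  refine hlow.trans_le (le_sInf ?_)
  rintro _ ⟨γ, hγ, rfl⟩
  have := hγ.ofReal_abs_log_sub_log_le hc.le ha hρ (p := z₁) le_rfl ⟨zero_le_one, le_rfl⟩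
  rwa [hγ.2.1] at this

theorem IsPathIn.norm_sub_le_mul_exp (hγ : IsPathIn Ω z₁ z₂ γ) (hc : 0 < c) (ha : a ∉ Ω)
    (hρ : ∀ w ∈ Ω, ENNReal.ofReal (c / ‖w - a‖) ≤ ρ w) (hlen : densityLength ρ γ 0 1 ≤ 1)
    {t : ℝ} (ht : t ∈ Icc (0 : ℝ) 1) :
    ‖γ t - a‖ ≤ ‖z₁ - a‖ * Real.exp (2 / c) ∧ ‖z₁ - a‖ ≤ ‖γ t - a‖ * Real.exp (2 / c) := by
  have hra : ∀ z ∈ Ω, 0 < ‖z - a‖ := fun z hz =>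
    norm_pos_iff.2 (sub_ne_zero.2 (ne_of_mem_of_not_mem hz ha))
  have h1 := hra _ (hγ.2.2.1 t ht)
  have h2 : 0 < ‖z₁ - a‖ := hra _ (hγ.1 ▸ hγ.2.2.1 0 ⟨le_rfl, zero_le_one⟩)
  have h := (hγ.ofReal_abs_log_sub_log_le hc.le ha hρ (p := a) (D := 0) (by simp) ht).trans hlen
  rw [ENNReal.ofReal_le_one] at h
  simp only [ne_eq, OfNat.ofNat_ne_zero, not_false_eq_true, zero_pow, add_zero, Real.log_pow,
    Nat.cast_ofNat, ← mul_sub, abs_mul, Nat.abs_ofNat] at h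
  have h' : |Real.log ‖γ t - a‖ - Real.log ‖z₁ - a‖| ≤ 2 / c := by
    rw [le_div_iff₀ hc]
    linarith
  rw [abs_le] at h'
  constructor
  · rw [← Real.log_le_log_iff h1 (by positivity), Real.log_mul h2.ne' (Real.exp_ne_zero _),
      Real.log_exp]
    linarith
  · rw [← Real.log_le_log_iff h2 (by positivity), Real.log_mul h1.ne' (Real.exp_ne_zero _),
      Real.log_exp]
    linarith

theorem IsPathIn.densityLength_one_le (hγ : IsPathIn Ω z₁ z₂ γ) (hc : 0 < c) (ha : a ∉ Ω)
    (hρ : ∀ w ∈ Ω, ENNReal.ofReal (c / ‖w - a‖) ≤ ρ w) {R : ℝ} (hR : 0 < R)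
    (hγR : ∀ t ∈ Icc (0 : ℝ) 1, ‖γ t - a‖ ≤ R) :
    densityLength (fun _ => 1) γ 0 1 ≤ ENNReal.ofReal (R / c) * densityLength ρ γ 0 1 := by
  rw [densityLength, densityLength, ← lintegral_const_mul' _ _ ENNReal.ofReal_ne_top]
  refine setLIntegral_mono' measurableSet_Icc fun t ht => ?_
  rw [← mul_assoc]
  refine mul_le_mul_left ?_ _
  have hpos : 0 < ‖γ t - a‖ :=
    norm_pos_iff.2 (sub_ne_zero.2 (ne_of_mem_of_not_mem (hγ.2.2.1 t ht) ha))
  calc (1 : ℝ≥0∞) = ENNReal.ofReal (R / c) * ENNReal.ofReal (c / R) := by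
        rw [← ENNReal.ofReal_mul (by positivity), div_mul_div_cancel₀ hc.ne', div_self hR.ne',
          ENNReal.ofReal_one]
    _ ≤ ENNReal.ofReal (R / c) * ρ (γ t) := by
        gcongr
        refine le_trans (ENNReal.ofReal_le_ofReal ?_) (hρ _ (hγ.2.2.1 t ht))
        have := hγR t ht
        gcongr

theorem exists_densityDist_lt_of_cauchy (hc : 0 < c) (hΩ : Ω ≠ univ)
    (hρ : ∀ a ∉ Ω, ∀ w ∈ Ω, ENNReal.ofReal (c / ‖w - a‖) ≤ ρ w) {u : ℕ → ℂ}
    (hu : ∀ n, u n ∈ Ω)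
    (hC : ∀ ε : ℝ≥0∞, 0 < ε → ∃ N, ∀ m ≥ N, ∀ n ≥ N, densityDist ρ Ω (u m) (u n) < ε) :
    ∃ w ∈ Ω, ∀ ε : ℝ≥0∞, 0 < ε → ∃ N, ∀ n ≥ N, densityDist ρ Ω (u n) w < ε := by
  obtain ⟨a, ha⟩ := (ne_univ_iff_exists_notMem Ω).1 hΩ
  obtain ⟨N, hN⟩ := hC 1 one_pos
  have hbound : ∀ n ≥ N, ∀ b ∉ Ω, ‖u n - b‖ ≤ ‖u N - b‖ * Real.exp (2 / c) ∧
      ‖u N - b‖ ≤ ‖u n - b‖ * Real.exp (2 / c) := by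
    intro n hn b hb
    obtain ⟨γ, hγ, hlt⟩ := exists_isPathIn_of_densityDist_lt (hN N le_rfl n hn)
    have := hγ.norm_sub_le_mul_exp hc hb (hρ b hb) hlt.le (t := 1) ⟨zero_le_one, le_rfl⟩
    rwa [hγ.2.1] at this
  set R := ‖u N - a‖ * Real.exp (2 / c) * Real.exp (2 / c) with hR_def
  have hR : 0 < R := by
    have : 0 < ‖u N - a‖ := norm_pos_iff.2 (sub_ne_zero.2 (ne_of_mem_of_not_mem (hu N) ha))
    positivity
  obtain ⟨w, -, φ, hφ, hw⟩ := tendsto_subseq_of_bounded (x := fun n => u (N + n))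
    (isBounded_closedBall (x := a) (r := ‖u N - a‖ * Real.exp (2 / c)))
    fun n => mem_closedBall_iff_norm.2 (hbound _ (Nat.le_add_right _ _) a ha).1
  have hwΩ : w ∈ Ω := by
    by_contra hw'
    have hlim : Tendsto (fun n => ‖u (N + φ n) - w‖ * Real.exp (2 / c)) atTop
        (𝓝 (‖w - w‖ * Real.exp (2 / c))) := ((hw.sub_const w).norm).mul_const _
    have := ge_of_tendsto' hlim fun n => (hbound _ (Nat.le_add_right _ _) w hw').2
    rw [sub_self, norm_zero, zero_mul, norm_le_zero_iff, sub_eq_zero] at this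
    exact hw' (this ▸ hu N)
  obtain ⟨χ, hχ, hχd⟩ := extraction_forall_of_eventually
    (P := fun k n => ∀ m ≥ n, densityDist ρ Ω (u (N + φ n)) (u (N + φ m)) < (1 / 4) ^ k) <| by
      intro k
      obtain ⟨K, hK⟩ := hC ((1 / 4) ^ k) (ENNReal.pow_pos (by simp) k)
      filter_upwards [eventually_ge_atTop K] with n hn m hm
      have h1 := hφ.le_apply (x := n)
      have h2 := hφ.le_apply (x := m)
      exact hK _ (by omega) _ (by omega)
  set v : ℕ → ℂ := fun k => u (N + φ (χ k)) with hv_def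
  have hvlim : Tendsto v atTop (𝓝 w) := hw.comp hχ.tendsto_atTop
  have hquarter : ∀ k, (1 / 4 : ℝ≥0∞) ^ k = ENNReal.ofReal ((1 / 4) ^ k) := fun k => by
    rw [ENNReal.ofReal_pow (by norm_num), ENNReal.ofReal_div_of_pos (by norm_num)]
    simp
  have hpath : ∀ k, ∃ γ, IsPathIn Ω (v k) (v (k + 1)) γ ∧ densityLength ρ γ 0 1 ≤ (1 / 4) ^ k ∧
      ∀ t ∈ Icc (0 : ℝ) 1, ‖derivWithin γ (Icc 0 1) t‖ ≤ 2 * (R / c * (1 / 4) ^ k) := by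
    intro k
    obtain ⟨γ, hγ, hlt⟩ := exists_isPathIn_of_densityDist_lt
      (hχd k (χ (k + 1)) (hχ.monotone (Nat.le_succ k)))
    have hlen1 : densityLength ρ γ 0 1 ≤ 1 :=
      hlt.le.trans (pow_le_one₀ zero_le (by simp))
    have hγR : ∀ t ∈ Icc (0 : ℝ) 1, ‖γ t - a‖ ≤ R := fun t ht =>
      (hγ.norm_sub_le_mul_exp hc ha (hρ a ha) hlen1 ht).1.trans <| by
        rw [hR_def]
        gcongr
        exact (hbound _ (Nat.le_add_right _ _) a ha).1
    have heuc : densityLength (fun _ => 1) γ 0 1 ≤ ENNReal.ofReal (R / c * (1 / 4) ^ k) := by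
      rw [ENNReal.ofReal_mul (by positivity), ← hquarter]
      exact (hγ.densityLength_one_le hc ha (hρ a ha) hR hγR).trans (by gcongr)
    obtain ⟨Q, hQ, hQl, hQd⟩ := hγ.exists_reparam (by positivity) heuc ρ
    exact ⟨Q, hQ, hQl.trans_le hlt.le, hQd⟩
  choose P hP hPl hPd using hpath
  have hvw : ∀ n, densityDist ρ Ω (v n) w ≤ (1 / 4) ^ n * ∑' k : ℕ, (1 / 4 : ℝ≥0∞) ^ k := by
    intro n
    have hsum : Summable fun k => 2 ^ k * (2 * (R / c * (1 / 4 : ℝ) ^ (n + k))) := by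
      refine ((summable_geometric_two).mul_left (2 * (R / c * (1 / 4) ^ n))).congr fun k => ?_
      rw [pow_add, show (1 / 4 : ℝ) ^ k = (1 / 2) ^ k * (1 / 2) ^ k by
        rw [← mul_pow]; norm_num]
      have : (2 : ℝ) ^ k * (1 / 2) ^ k = 1 := by rw [← mul_pow]; norm_num
      linear_combination (-2 * (R / c) * (1 / 4) ^ n * (1 / 2) ^ k) * this
    refine (densityDist_le_tsum (u := fun k => v (n + k)) (P := fun k => P (n + k)) (ρ := ρ)
      (fun k => hP (n + k)) (fun k => hPd (n + k)) hsum ?_ hwΩ).trans ?_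
    · exact hvlim.comp (tendsto_add_atTop_nat n |>.congr fun k => add_comm k n)
    · rw [← ENNReal.tsum_mul_left]
      exact ENNReal.tsum_le_tsum fun k => (hPl (n + k)).trans_eq (pow_add _ _ _)
  have hlim : Tendsto (fun n => (1 / 4 : ℝ≥0∞) ^ n * ∑' k : ℕ, (1 / 4 : ℝ≥0∞) ^ k) atTop
      (𝓝 0) := by
    have hq : (1 / 4 : ℝ≥0∞) < 1 := by
      rw [ENNReal.div_lt_iff] <;> norm_num
    have hS : (∑' k : ℕ, (1 / 4 : ℝ≥0∞) ^ k) ≠ ∞ := by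
      rw [ENNReal.tsum_geometric, ENNReal.inv_ne_top]
      exact (tsub_pos_of_lt hq).ne'
    simpa using ENNReal.Tendsto.mul_const
      (ENNReal.tendsto_pow_atTop_nhds_zero_of_lt_one hq) (Or.inr hS)
  refine ⟨w, hwΩ, fun ε hε => ?_⟩
  obtain ⟨K, hK⟩ := hC (ε / 2) (ENNReal.half_pos hε.ne')
  obtain ⟨j, hj, hjK⟩ := ((hlim.eventually_lt_const (ENNReal.half_pos hε.ne')).and
    (eventually_ge_atTop K)).exists
  refine ⟨K, fun n hn => (densityDist_triangle ρ hwΩ (z₂ := v j)).trans_lt ?_⟩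
  have h1 := hφ.le_apply (x := χ j)
  have h2 := hχ.le_apply (x := j)
  calc _ < ε / 2 + ε / 2 := ENNReal.add_lt_add (hK n hn _ (by omega)) ((hvw j).trans_lt hj)
    _ = ε := ENNReal.add_halves ε

end Complete

/-- on a hyperbolic domain, the generalized Hurwitz distance makes
`Ω` a complete metric space. -/
theorem genHurwitz_complete_metric
    (Y Ω : Set ℂ) (hY : IsPlaneDomain Y) (hYp : Y ≠ Set.univ)
    (hΩ : IsPlaneDomain Ω) (hhyp : ∃ a b : ℂ, a ∉ Ω ∧ b ∉ Ω ∧ a ≠ b) :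
    (∀ w₁ ∈ Ω, ∀ w₂ ∈ Ω, genHurwitzDist Y Ω w₁ w₂ = genHurwitzDist Y Ω w₂ w₁) ∧
    (∀ w₁ ∈ Ω, ∀ w₂ ∈ Ω, ∀ w₃ ∈ Ω,
      genHurwitzDist Y Ω w₁ w₃ ≤ genHurwitzDist Y Ω w₁ w₂ + genHurwitzDist Y Ω w₂ w₃) ∧
    (∀ w₁ ∈ Ω, ∀ w₂ ∈ Ω, w₁ ≠ w₂ → 0 < genHurwitzDist Y Ω w₁ w₂) ∧
    (∀ u : ℕ → ℂ, (∀ n, u n ∈ Ω) →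
      (∀ ε : ℝ≥0∞, 0 < ε → ∃ N : ℕ, ∀ m ≥ N, ∀ n ≥ N,
        genHurwitzDist Y Ω (u m) (u n) < ε) →
      ∃ w ∈ Ω, ∀ ε : ℝ≥0∞, 0 < ε → ∃ N : ℕ, ∀ n ≥ N,
        genHurwitzDist Y Ω (u n) w < ε) := by

  have hΩu : Ω ≠ univ := by
    obtain ⟨a, -, ha, -⟩ := hhyp
    exact (ne_univ_iff_exists_notMem Ω).2 ⟨a, ha⟩
  have hρ : ∀ a ∉ Ω, ∀ w ∈ Ω, ENNReal.ofReal (1 / 2000 / ‖w - a‖) ≤ genHurwitzDensity Y Ω w :=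
    fun a ha w hw => ofReal_le_genHurwitzDensity hY.1 hYp hw ha
  have hdist : genHurwitzDist Y Ω = densityDist (genHurwitzDensity Y Ω) Ω := rfl
  rw [hdist]
  refine ⟨fun w₁ _ w₂ _ => (densityDist_symm_le _ _ _ _).antisymm (densityDist_symm_le _ _ _ _),
    fun w₁ _ w₂ _ w₃ hw₃ => densityDist_triangle _ hw₃, fun w₁ hw₁ w₂ _ hne => ?_,
    fun u hu hC => exists_densityDist_lt_of_cauchy (by norm_num) hΩu hρ hu hC⟩
  obtain ⟨a, -, ha, -⟩ := hhyp
  exact densityDist_pos (by norm_num) ha (hρ a ha) hw₁ hne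
end
end

section
/- Let Y be a proper subdomain of ℂ and let Ω, Δ be subdomains of ℂ. If h is a one-to-one holomorphic map from Ω to Δ, then η_Δ^Y(h(w₁), h(w₂)) ≤ η_Ω^Y(w₁, w₂) for all w₁, w₂ ∈ Ω, where the two sides are the generalized Hurwitz distances in Δ and Ω respectively, with basepoint domain Y. -/
open Complex Set Metric
open scoped ENNReal

noncomputable section

/-- The generalized Hurwitz density does not increase under injective holomorphic maps. -/
theorem genHurwitzDensity_mul_norm_deriv_le {Y Ω Δ : Set ℂ} (hY : IsOpen Y) (hΩ : IsOpen Ω)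
    {h : ℂ → ℂ} (hhol : DifferentiableOn ℂ h Ω) (hmaps : Set.MapsTo h Ω Δ)
    (hinj : Set.InjOn h Ω) {w : ℂ} (hw : w ∈ Ω) :
    genHurwitzDensity Y Δ (h w) * ENNReal.ofReal ‖deriv h w‖ ≤ genHurwitzDensity Y Ω w := by
  by_cases hd : deriv h w = 0
  · simp [hd]
  refine le_sInf ?_
  rintro x ⟨s, hs, g, hg, hgm, rfl, hgs, hg', rfl⟩
  have hcomp : deriv (h ∘ g) s = deriv h (g s) * deriv g s :=
    deriv_comp s (hhol.differentiableAt (hΩ.mem_nhds hw)) (hg.differentiableAt (hY.mem_nhds hs))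
  have hle : genHurwitzDensity Y Δ (h (g s)) ≤
      ENNReal.ofReal (hurwitzDensity Y s / ‖deriv (h ∘ g) s‖) :=
    sInf_le ⟨s, hs, h ∘ g, hhol.comp hg hgm, hmaps.comp hgm, rfl,
      fun t ht hts heq => hgs t ht hts (hinj (hgm ht) hw heq),
      by rw [hcomp]; exact mul_ne_zero hd hg', rfl⟩
  refine (mul_le_mul_left hle _).trans ?_
  rw [← ENNReal.ofReal_mul' (norm_nonneg _), hcomp, norm_mul]
  have h1 : ‖deriv h (g s)‖ ≠ 0 := norm_ne_zero_iff.2 hd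
  have h2 : ‖deriv g s‖ ≠ 0 := norm_ne_zero_iff.2 hg'
  refine le_of_eq (congrArg _ ?_)
  field_simp

/-- A holomorphic map carries paths to paths. -/
theorem IsPathIn.comp {Ω Δ : Set ℂ} (hΩ : IsOpen Ω) {h : ℂ → ℂ}
    (hhol : DifferentiableOn ℂ h Ω) (hmaps : Set.MapsTo h Ω Δ) {w₁ w₂ : ℂ} {γ : ℝ → ℂ}
    (hγ : IsPathIn Ω w₁ w₂ γ) : IsPathIn Δ (h w₁) (h w₂) (h ∘ γ) := by
  obtain ⟨h0, h1, hm, hc⟩ := hγ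
  refine ⟨by simp [h0], by simp [h1], fun t ht => hmaps (hm t ht), ?_⟩
  exact ((hhol.contDiffOn hΩ).restrict_scalars ℝ).comp hc hm

/-- one-to-one holomorphic maps are global contractions for the
generalized Hurwitz distance. -/
theorem genHurwitz_dist_decreasing_injective
    (Y Ω Δ : Set ℂ) (hY : IsPlaneDomain Y) (hYp : Y ≠ Set.univ)
    (hΩ : IsPlaneDomain Ω) (hΔ : IsPlaneDomain Δ)
    (h : ℂ → ℂ) (hhol : DifferentiableOn ℂ h Ω) (hmaps : Set.MapsTo h Ω Δ)
    (hinj : Set.InjOn h Ω) :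
    ∀ w₁ ∈ Ω, ∀ w₂ ∈ Ω,
      genHurwitzDist Y Δ (h w₁) (h w₂) ≤ genHurwitzDist Y Ω w₁ w₂ := by
  intro w₁ _ w₂ _
  refine le_sInf ?_
  rintro L ⟨γ, hγ, rfl⟩
  refine sInf_le_of_le ⟨h ∘ γ, hγ.comp hΩ.1 hhol hmaps, rfl⟩ ?_
  refine MeasureTheory.setLIntegral_mono' measurableSet_Icc fun t ht => ?_
  have hmem := hγ.2.2.1 t ht
  have hγd : DifferentiableWithinAt ℝ γ (Set.Icc 0 1) t :=
    hγ.2.2.2.differentiableOn one_ne_zero t ht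
  have hderiv : derivWithin (h ∘ γ) (Set.Icc (0 : ℝ) 1) t =
      deriv h (γ t) * derivWithin γ (Set.Icc (0 : ℝ) 1) t :=
    ((hhol.differentiableAt (hΩ.1.mem_nhds hmem)).hasDerivAt.comp_hasDerivWithinAt t
      hγd.hasDerivWithinAt).derivWithin (uniqueDiffOn_Icc_zero_one t ht)
  rw [hderiv, norm_mul, ENNReal.ofReal_mul (norm_nonneg _), ← mul_assoc]
  exact mul_le_mul_left
    (genHurwitzDensity_mul_norm_deriv_le hY.1 hΩ.1 hhol hmaps hinj hmem) _
end
end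

section
/- Let Y₁, Y₂ be proper subdomains of ℂ and let Ω be any subdomain of ℂ. Suppose that for every point b ∈ Y₂ there exist a point a ∈ Y₁ and a holomorphic covering map h_b from Y₁∖{a} onto Y₂∖{b} which extends to a holomorphic map from Y₁ onto Y₂ with h_b(a) = b, h_b(w) ≠ b for all w ∈ Y₁∖{a}, and h_b'(a) ≠ 0. Then η_Ω^{Y₁}(ζ) ≤ η_Ω^{Y₂}(ζ) for all ζ ∈ Ω. -/
open Complex Set Metric
open scoped ENNReal

noncomputable section

open scoped Topology

/-- An injective holomorphic function on an open set has nowhere vanishing derivative. -/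
theorem deriv_ne_zero_of_injOn {h : ℂ → ℂ} {V : Set ℂ} (hV : IsOpen V)
    (hd : DifferentiableOn ℂ h V) (hi : InjOn h V) {x : ℂ} (hx : x ∈ V) : deriv h x ≠ 0 := by
  intro h0
  have han : ∀ z ∈ V, AnalyticAt ℂ h z := fun z hz ↦ hd.analyticAt (hV.mem_nhds hz)
  have hnc : ∀ z ∈ V, ¬ ∀ᶠ w in 𝓝 z, h w = h z := by
    intro z hz hc
    have h1 : ∀ᶠ w in 𝓝[≠] z, w = z := by
      filter_upwards [nhdsWithin_le_nhds hc, nhdsWithin_le_nhds (hV.mem_nhds hz)] with w hw hwV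
      exact hi hwV hz hw
    obtain ⟨w, hw, hw'⟩ := (h1.and self_mem_nhdsWithin).exists
    exact hw' hw
  have hop : ∀ z ∈ V, 𝓝 (h z) ≤ Filter.map h (𝓝 z) := fun z hz ↦
    (han z hz).eventually_constant_or_nhds_le_map_nhds.resolve_left (hnc z hz)
  have hne : ∀ᶠ z in 𝓝[≠] x, deriv h z ≠ 0 := by
    refine (han x hx).deriv.eventually_eq_zero_or_eventually_ne_zero.resolve_left fun hz ↦ ?_
    obtain ⟨r, hr, hball⟩ := Metric.mem_nhds_iff.1 (hz.and (hV.mem_nhds hx))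
    refine hnc x hx ?_
    filter_upwards [Metric.ball_mem_nhds x hr] with w hw
    exact isOpen_ball.is_const_of_deriv_eq_zero (convex_ball x r).isPreconnected
      (fun z hz' ↦ (hd z (hball hz').2).mono fun y hy ↦ (hball hy).2)
      (fun z hz' ↦ (hball hz').1) hw (mem_ball_self hr)
  set σ : ℂ → ℂ := Function.invFunOn h V
  have hσ : ∀ z ∈ V, σ (h z) = z := fun z hz ↦ hi.leftInvOn_invFunOn hz
  have hσc : ∀ z ∈ V, ContinuousAt σ (h z) := by
    intro z hz
    unfold ContinuousAt
    rw [hσ z hz]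
    refine Filter.Tendsto.mono_left ?_ (hop z hz)
    rw [Filter.tendsto_map'_iff]
    refine Filter.Tendsto.congr' ?_ Filter.tendsto_id
    filter_upwards [hV.mem_nhds hz] with w hw using (hσ w hw).symm
  have hinv : ∀ z ∈ V, h ∘ σ =ᶠ[𝓝 (h z)] id := by
    intro z hz
    refine hop z hz ?_
    rw [Filter.mem_map]
    filter_upwards [hV.mem_nhds hz] with w hw
    simp [hσ w hw]
  have hσd : ∀ᶠ y in 𝓝[≠] (h x), DifferentiableAt ℂ σ y := by
    rw [eventually_nhdsWithin_iff] at hne ⊢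
    refine hop x hx ?_
    rw [Filter.mem_map]
    filter_upwards [hne, hV.mem_nhds hx] with z hz hzV hzx
    have hz' : deriv h z ≠ 0 := hz fun e ↦ hzx (by rw [mem_singleton_iff.1 e]; rfl)
    refine (HasDerivAt.of_local_left_inverse (f := h) (hσc z hzV) ?_ hz'
      (hinv z hzV)).differentiableAt
    rw [hσ z hzV]
    exact (han z hzV).differentiableAt.hasDerivAt
  refine not_differentiableAt_of_local_left_inverse_hasDerivAt_zero ?_ (hinv x hx)
    (Complex.analyticAt_of_differentiable_on_punctured_nhds_of_continuousAt hσd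
      (hσc x hx)).differentiableAt
  rw [hσ x hx, ← h0]
  exact (han x hx).differentiableAt.hasDerivAt

/-- A holomorphic covering map between subsets of the plane, with open source, has nowhere
vanishing derivative. -/
theorem deriv_ne_zero_of_isCoveringMap {h : ℂ → ℂ} {S T : Set ℂ} (hS : IsOpen S)
    (hd : DifferentiableOn ℂ h S) (hm : MapsTo h S T)
    (cov : IsCoveringMap (hm.restrict h S T)) {x : ℂ} (hx : x ∈ S) : deriv h x ≠ 0 := by
  obtain ⟨e, hxe, he⟩ := cov.isLocalHomeomorph ⟨x, hx⟩
  refine deriv_ne_zero_of_injOn (V := Subtype.val '' e.source)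
    (hS.isOpenMap_subtype_val _ e.open_source) (hd.mono (by rintro _ ⟨y, -, rfl⟩; exact y.2))
    ?_ ⟨_, hxe, rfl⟩
  rintro _ ⟨y, hy, rfl⟩ _ ⟨z, hz, rfl⟩ hyz
  congr 1
  refine e.injOn hy hz ?_
  rw [← he]
  exact Subtype.ext hyz

/-- A punctured-disk map `g` whose target is covered by `h`, and which near the puncture lifts to a
map `k`, has a lift along the exponential that agrees with `k ∘ exp` far to the left and descends
through `exp`. -/
theorem exists_lift_comp_exp {h g k : ℂ → ℂ} {S T : Set ℂ} (hm : MapsTo h S T)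
    (cov : IsCoveringMap (hm.restrict h S T))
    (hg : ContinuousOn g (unitDisk \ {0})) (hgT : MapsTo g (unitDisk \ {0}) T)
    {δ : ℝ} (hδ : 0 < δ) (hδ1 : δ ≤ 1) (hk : ContinuousOn k (ball 0 δ \ {0}))
    (hkS : MapsTo k (ball 0 δ \ {0}) S) (hkg : ∀ t ∈ ball (0 : ℂ) δ \ {0}, h (k t) = g t) :
    ∃ Γ : ℂ → ℂ, ContinuousOn Γ {z | z.re < 0} ∧ MapsTo Γ {z | z.re < 0} S ∧
      (∀ z, z.re < 0 → h (Γ z) = g (exp z)) ∧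
      (∀ z w, z.re < 0 → w.re < 0 → exp z = exp w → Γ z = Γ w) ∧
      ∀ z, z.re < Real.log δ → Γ z = k (exp z) := by
  have hexp : ∀ z : ℂ, z.re < 0 → exp z ∈ unitDisk \ {0} := fun z hz ↦
    ⟨by simpa [unitDisk, Complex.norm_exp] using hz, exp_ne_zero z⟩
  have hexpδ : ∀ z : ℂ, z.re < Real.log δ → exp z ∈ ball (0 : ℂ) δ \ {0} := fun z hz ↦
    ⟨by simpa [Complex.norm_exp] using (Real.lt_log_iff_exp_lt hδ).1 hz, exp_ne_zero z⟩
  have hlog : Real.log δ ≤ 0 := Real.log_nonpos hδ.le hδ1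
  have hcH : Convex ℝ {z : ℂ | z.re < 0} := convex_halfSpace_re_lt 0
  have hcF : Convex ℝ {z : ℂ | z.re < Real.log δ} := convex_halfSpace_re_lt _
  let z₀ : ℂ := ((Real.log δ - 1 : ℝ) : ℂ)
  have hz₀ : z₀.re < Real.log δ := by simp [z₀]
  have : ContractibleSpace {z : ℂ | z.re < 0} := hcH.contractibleSpace ⟨z₀, hz₀.trans_le hlog⟩
  have : LocallyPathConnectedSpace {z : ℂ | z.re < 0} := hcH.locallyPathConnectedSpace
  have : PreconnectedSpace {z : ℂ | z.re < Real.log δ} :=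
    Subtype.preconnectedSpace hcF.isPreconnected
  let f : C({z : ℂ | z.re < 0}, T) :=
    ⟨fun z ↦ ⟨g (exp z), hgT (hexp z z.2)⟩, Continuous.subtype_mk
      (hg.comp_continuous (f := fun z : {z : ℂ | z.re < 0} ↦ exp z) (by fun_prop)
        fun z ↦ hexp z z.2) _⟩
  let κ : {z : ℂ | z.re < Real.log δ} → S := fun z ↦ ⟨k (exp z), hkS (hexpδ z z.2)⟩
  have hκ : Continuous κ := Continuous.subtype_mk
    (hk.comp_continuous (f := fun z : {z : ℂ | z.re < Real.log δ} ↦ exp z) (by fun_prop)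
      fun z ↦ hexpδ z z.2) _
  obtain ⟨Φ, ⟨hΦ₀, hΦ⟩, -⟩ := cov.existsUnique_continuousMap_lifts f ⟨z₀, hz₀.trans_le hlog⟩
    (κ ⟨z₀, hz₀⟩) (Subtype.ext (hkg _ (hexpδ z₀ hz₀)))
  have hΦh : ∀ z (hz : z ∈ {z : ℂ | z.re < 0}), h (Φ ⟨z, hz⟩) = g (exp z) := fun z hz ↦
    congrArg Subtype.val (congrFun hΦ ⟨z, hz⟩)
  have hleft : ∀ z (hz : z.re < Real.log δ), Φ ⟨z, hz.trans_le hlog⟩ = κ ⟨z, hz⟩ := by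
    intro z hz
    refine congrFun (cov.eq_of_comp_eq
      (g₁ := fun z : {z : ℂ | z.re < Real.log δ} ↦ Φ ⟨z, z.2.trans_le hlog⟩) (g₂ := κ)
      (by fun_prop) hκ ?_ ⟨z₀, hz₀⟩ hΦ₀) ⟨z, hz⟩
    funext w
    exact Subtype.ext ((hΦh _ _).trans (hkg _ (hexpδ w w.2)).symm)
  have hshift : ∀ (n : ℤ) z (hz : z.re < 0) (hz' : (z + n * (2 * Real.pi * I)).re < 0),
      Φ ⟨z + n * (2 * Real.pi * I), hz'⟩ = Φ ⟨z, hz⟩ := by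
    intro n z hz hz'
    have hre : ∀ w : ℂ, (w + n * (2 * Real.pi * I)).re = w.re := by intro w; simp
    have hper : ∀ w : ℂ, exp (w + n * (2 * Real.pi * I)) = exp w := fun w ↦
      exp_periodic.int_mul n w
    refine congrFun (cov.eq_of_comp_eq
      (g₁ := fun z : {z : ℂ | z.re < 0} ↦
        Φ ⟨z + n * (2 * Real.pi * I), (hre z).trans_lt z.2⟩) (g₂ := Φ)
      (by fun_prop) Φ.continuous ?_ ⟨z₀, hz₀.trans_le hlog⟩ ?_) ⟨z, hz⟩
    · funext w
      exact Subtype.ext ((hΦh _ _).trans ((congrArg g (hper w)).trans (hΦh w w.2).symm))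
    · refine (hleft _ ((hre _).trans_lt hz₀)).trans (Eq.trans ?_ (hleft _ hz₀).symm)
      exact Subtype.ext (congrArg k (hper z₀))
  classical
  refine ⟨fun z ↦ if hz : z.re < 0 then Φ ⟨z, hz⟩ else 0, ?_, ?_, ?_, ?_, ?_⟩
  · rw [continuousOn_iff_continuous_domRestrict]
    convert! continuous_subtype_val.comp Φ.continuous using 1
    funext z
    exact dif_pos z.2
  · intro z hz
    simp only [dif_pos (show z.re < 0 from hz)]
    exact (Φ ⟨z, hz⟩).2
  · intro z hz
    simp only [dif_pos hz]
    exact hΦh z hz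
  · intro z w hz hw hzw
    simp only [dif_pos hz, dif_pos hw]
    obtain ⟨n, rfl⟩ := exp_eq_exp_iff_exists_int.1 hzw
    rw [hshift n w hw hz]
  · intro z hz
    simp only [dif_pos (hz.trans_le hlog)]
    rw [hleft z hz]

/-- Lifting of a holomorphic disk through a map that is a covering off a simple fibre point. -/
theorem exists_lift_of_isCoveringMap {h g : ℂ → ℂ} {Y Y' : Set ℂ} {a b : ℂ} (hY : IsOpen Y)
    (ha : a ∈ Y) (hd : DifferentiableOn ℂ h Y) (hab : h a = b) (h' : deriv h a ≠ 0)
    (hm : MapsTo h (Y \ {a}) (Y' \ {b}))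
    (cov : IsCoveringMap (hm.restrict h (Y \ {a}) (Y' \ {b})))
    (hg : DifferentiableOn ℂ g unitDisk) (hgY : MapsTo g unitDisk Y') (hg0 : g 0 = b)
    (hgb : ∀ t ∈ unitDisk, t ≠ 0 → g t ≠ b) :
    ∃ G : ℂ → ℂ, DifferentiableOn ℂ G unitDisk ∧ MapsTo G unitDisk Y ∧ G 0 = a ∧
      (∀ t ∈ unitDisk, t ≠ 0 → G t ≠ a) ∧ ∀ t ∈ unitDisk, h (G t) = g t := by
  have hUo : IsOpen unitDisk := isOpen_ball
  have h0U : (0 : ℂ) ∈ unitDisk := mem_ball_self one_pos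
  have hha : AnalyticAt ℂ h a := hd.analyticAt (hY.mem_nhds ha)
  have hga : AnalyticAt ℂ g 0 := hg.analyticAt (hUo.mem_nhds h0U)
  set σ : ℂ → ℂ := hha.hasStrictDerivAt.localInverse _ _ _ h'
  have hσa : σ b = a := by
    rw [← hab]; exact HasStrictFDerivAt.localInverse_apply_image ..
  have hσan : AnalyticAt ℂ σ (g 0) := by
    rw [hg0, ← hab]; exact hha.analyticAt_localInverse h'
  have hσr : ∀ᶠ y in 𝓝 (g 0), h (σ y) = y := by
    rw [hg0, ← hab]; exact hha.hasStrictDerivAt.eventually_right_inverse h'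
  have hkan : AnalyticAt ℂ (σ ∘ g) 0 := hσan.comp hga
  have hk0 : (σ ∘ g) 0 = a := by simp [hg0, hσa]
  have hkY : ∀ᶠ t in 𝓝 (0 : ℂ), (σ ∘ g) t ∈ Y :=
    hkan.continuousAt.eventually_mem (by rw [hk0]; exact hY.mem_nhds ha)
  obtain ⟨δ', hδ', hball⟩ := Metric.mem_nhds_iff.1 (hkan.eventually_analyticAt.and
    (hkY.and (hga.continuousAt.eventually hσr)))
  set δ := min δ' 1
  have hδ : 0 < δ := lt_min hδ' one_pos
  have hδ1 : δ ≤ 1 := min_le_right _ _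
  replace hball : ∀ t ∈ ball (0 : ℂ) δ, AnalyticAt ℂ (σ ∘ g) t ∧ (σ ∘ g) t ∈ Y ∧
      h (σ (g t)) = g t := fun t ht ↦ hball (ball_subset_ball (min_le_left _ _) ht)
  have hsub : ball (0 : ℂ) δ ⊆ unitDisk := ball_subset_ball hδ1
  obtain ⟨Γ, hΓc, hΓS, hΓh, hΓexp, hΓk⟩ := exists_lift_comp_exp (k := σ ∘ g) hm cov
    (hg.continuousOn.mono sdiff_subset)
    (fun t ht ↦ ⟨hgY ht.1, hgb t ht.1 ht.2⟩) hδ hδ1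
    (fun t ht ↦ (hball t ht.1).1.continuousAt.continuousWithinAt)
    (fun t ht ↦ ⟨(hball t ht.1).2.1, fun e ↦ hgb t (hsub ht.1) ht.2 <| by
      rw [← (hball t ht.1).2.2, ← hab]; exact congrArg h e⟩)
    (fun t ht ↦ (hball t ht.1).2.2)
  have hlog : ∀ t ∈ unitDisk, t ≠ 0 → (log t).re < 0 := fun t ht ht0 ↦ by
    rw [log_re]; exact Real.log_neg (norm_pos_iff.2 ht0) (by simpa [unitDisk] using ht)
  set G : ℂ → ℂ := fun t ↦ if t = 0 then a else Γ (log t)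
  have hG0 : G 0 = a := if_pos rfl
  have hGne : ∀ t, t ≠ 0 → G t = Γ (log t) := fun t ht ↦ if_neg ht
  have hGS : ∀ t ∈ unitDisk, t ≠ 0 → G t ∈ Y \ {a} := fun t ht ht0 ↦ by
    rw [hGne t ht0]; exact hΓS (hlog t ht ht0)
  have hhG : ∀ t ∈ unitDisk, h (G t) = g t := fun t ht ↦ by
    rcases eq_or_ne t 0 with rfl | ht0
    · rw [hG0, hg0, hab]
    · rw [hGne t ht0, hΓh _ (hlog t ht ht0), exp_log ht0]
  refine ⟨G, fun t ht ↦ DifferentiableAt.differentiableWithinAt ?_, fun t ht ↦ ?_, hG0,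
    fun t ht ht0 ↦ (hGS t ht ht0).2, hhG⟩
  · rcases eq_or_ne t 0 with rfl | ht0
    · refine hkan.differentiableAt.congr_of_eventuallyEq ?_
      filter_upwards [Metric.ball_mem_nhds (0 : ℂ) hδ] with s hs
      rcases eq_or_ne s 0 with rfl | hs0
      · rw [hG0, hk0]
      · rw [hGne s hs0, hΓk, exp_log hs0]
        rw [log_re]
        exact Real.log_lt_log (norm_pos_iff.2 hs0) (by simpa using hs)
    · have hlc : ContinuousAt (fun s ↦ log t + log (s / t)) t :=
        continuousAt_const.add ((continuousAt_id.div_const t).clog (by simp [ht0]))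
      have hlt : log t + log (t / t) = log t := by simp [ht0]
      have hGc : ContinuousAt G t := by
        have hH : IsOpen {z : ℂ | z.re < 0} := isOpen_lt continuous_re continuous_const
        have h1 : ContinuousAt (fun s ↦ Γ (log t + log (s / t))) t := by
          refine ContinuousAt.comp (g := Γ) ?_ hlc
          rw [hlt]
          exact hΓc.continuousAt (hH.mem_nhds (hlog t ht ht0))
        refine h1.congr ?_
        have h2 : ∀ᶠ s in 𝓝 t, (log t + log (s / t)).re < 0 :=
          hlc.eventually_mem (by rw [hlt]; exact hH.mem_nhds (hlog t ht ht0))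
        filter_upwards [h2, hUo.mem_nhds ht, eventually_ne_nhds ht0] with s hs hsU hs0
        rw [hGne s hs0]
        refine hΓexp _ _ hs (hlog s hsU hs0) ?_
        rw [exp_add, exp_log ht0, exp_log (div_ne_zero hs0 ht0), exp_log hs0]
        field_simp
      refine (HasDerivAt.of_comp_left (f := h) (h := g) hGc
        (hd.differentiableAt (hY.mem_nhds (hGS t ht ht0).1)).hasDerivAt
        (hg.differentiableAt (hUo.mem_nhds ht)).hasDerivAt ?_ ?_).differentiableAt
      · exact deriv_ne_zero_of_isCoveringMap (hY.sdiff isClosed_singleton)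
          (hd.mono sdiff_subset) hm cov (hGS t ht ht0)
      · filter_upwards [hUo.mem_nhds ht] with s hs using hhG s hs
  · rcases eq_or_ne t 0 with rfl | ht0
    · rwa [hG0]
    · exact (hGS t ht ht0).1

/-- Rotating a holomorphic disk makes its derivative at the centre positive. -/
theorem norm_deriv_mem_hurwitz_set {Ω : Set ℂ} {w : ℂ} {F : ℂ → ℂ}
    (hF : DifferentiableOn ℂ F unitDisk) (hFΩ : MapsTo F unitDisk Ω) (hF0 : F 0 = w)
    (hFw : ∀ t ∈ unitDisk, t ≠ 0 → F t ≠ w) (hF' : deriv F 0 ≠ 0) :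
    0 < ‖deriv F 0‖ ∧ ∃ h : ℂ → ℂ, DifferentiableOn ℂ h unitDisk ∧
      MapsTo h unitDisk Ω ∧ h 0 = w ∧ (∀ t ∈ unitDisk, t ≠ 0 → h t ≠ w) ∧
      deriv h 0 = (‖deriv F 0‖ : ℂ) := by
  have hn : (‖deriv F 0‖ : ℂ) ≠ 0 := by simpa using hF'
  set u : ℂ := ‖deriv F 0‖ / deriv F 0
  have hu : ‖u‖ = 1 := by simp [u, hF']
  have hu0 : u ≠ 0 := div_ne_zero hn hF'
  have hmaps : MapsTo (fun t ↦ u * t) unitDisk unitDisk := fun t ht ↦ by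
    simpa [unitDisk, hu] using ht
  refine ⟨norm_pos_iff.2 hF', fun t ↦ F (u * t), hF.comp (by fun_prop) hmaps,
    fun t ht ↦ hFΩ (hmaps ht), by simpa using hF0,
    fun t ht ht0 ↦ hFw _ (hmaps ht) (mul_ne_zero hu0 ht0), ?_⟩
  rw [deriv_comp_mul_left]
  simp [u, hF']

/-- The Hurwitz radius scales by the derivative under a map that is a covering off a simple fibre
point. -/
theorem hurwitzRadius_eq_norm_deriv_mul {h : ℂ → ℂ} {Y Y' : Set ℂ} {a b : ℂ} (hY : IsOpen Y)
    (ha : a ∈ Y) (hd : DifferentiableOn ℂ h Y) (hYY' : MapsTo h Y Y') (hab : h a = b)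
    (hb : ∀ w ∈ Y, w ≠ a → h w ≠ b) (h' : deriv h a ≠ 0)
    (hm : MapsTo h (Y \ {a}) (Y' \ {b}))
    (cov : IsCoveringMap (hm.restrict h (Y \ {a}) (Y' \ {b}))) :
    hurwitzRadius Y' b = ‖deriv h a‖ * hurwitzRadius Y a := by
  have hU : unitDisk ∈ 𝓝 (0 : ℂ) := ball_mem_nhds 0 one_pos
  have hda : DifferentiableAt ℂ h a := hd.differentiableAt (hY.mem_nhds ha)
  unfold hurwitzRadius
  rw [← smul_eq_mul, ← Real.sSup_smul_of_nonneg (norm_nonneg _)]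
  congr 1
  ext r
  rw [Set.mem_smul_set]
  constructor
  · rintro ⟨hr, g, hg, hgY, hg0, hgb, hg'⟩
    obtain ⟨G, hG, hGY, hG0, hGa, hhG⟩ :=
      exists_lift_of_isCoveringMap hY ha hd hab h' hm cov hg hgY hg0 hgb
    have hcomp : (r : ℂ) = deriv h a * deriv G 0 := by
      rw [← hg', ← hG0, ← deriv_comp _ (by rwa [hG0]) (hG.differentiableAt hU)]
      refine Filter.EventuallyEq.deriv_eq ?_
      filter_upwards [hU] with t ht using (hhG t ht).symm
    have hG' : deriv G 0 ≠ 0 := by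
      intro e
      rw [e, mul_zero] at hcomp
      exact hr.ne' (by exact_mod_cast hcomp)
    refine ⟨_, norm_deriv_mem_hurwitz_set hG hGY hG0 hGa hG', ?_⟩
    rw [smul_eq_mul, ← norm_mul, ← hcomp, Complex.norm_real, Real.norm_of_nonneg hr.le]
  · rintro ⟨r, ⟨hr, F, hF, hFY, hF0, hFa, hF'⟩, rfl⟩
    have hcomp : deriv (h ∘ F) 0 = deriv h a * r := by
      rw [deriv_comp _ (by rwa [hF0]) (hF.differentiableAt hU), hF0, hF']
    have key := norm_deriv_mem_hurwitz_set (F := h ∘ F) (hd.comp hF hFY) (hYY'.comp hFY)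
      (by simp [hF0, hab]) (fun t ht ht0 ↦ hb _ (hFY ht) (hFa t ht ht0))
      (by rw [hcomp]; exact mul_ne_zero h' (by exact_mod_cast hr.ne'))
    have hnorm : ‖deriv (h ∘ F) 0‖ = ‖deriv h a‖ • r := by
      rw [hcomp, norm_mul, Complex.norm_real, Real.norm_of_nonneg hr.le, smul_eq_mul]
    rwa [hnorm] at key

/-- comparison of generalized Hurwitz densities when the basepoint
domain `Y₂` is holomorphically covered from `Y₁` in the Hurwitz sense. -/
theorem genHurwitz_base_comparison
    (Y₁ Y₂ Ω : Set ℂ) (hY₁ : IsPlaneDomain Y₁) (hY₁p : Y₁ ≠ Set.univ)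
    (hY₂ : IsPlaneDomain Y₂) (hY₂p : Y₂ ≠ Set.univ) (hΩ : IsPlaneDomain Ω)
    (hcov : ∀ b ∈ Y₂, ∃ a ∈ Y₁, ∃ hb : ℂ → ℂ,
      DifferentiableOn ℂ hb Y₁ ∧ Set.MapsTo hb Y₁ Y₂ ∧ Set.SurjOn hb Y₁ Y₂ ∧
      hb a = b ∧ (∀ w ∈ Y₁, w ≠ a → hb w ≠ b) ∧ deriv hb a ≠ 0 ∧
      ∃ hm : Set.MapsTo hb (Y₁ \ {a}) (Y₂ \ {b}),
        Set.SurjOn hb (Y₁ \ {a}) (Y₂ \ {b}) ∧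
        IsCoveringMap (Set.MapsTo.restrict hb (Y₁ \ {a}) (Y₂ \ {b}) hm)) :
    ∀ ζ ∈ Ω, genHurwitzDensity Y₁ Ω ζ ≤ genHurwitzDensity Y₂ Ω ζ := by
  intro ζ _
  refine le_sInf ?_
  rintro _ ⟨b, hb, f, hf, hfΩ, hfb, hfne, hf', rfl⟩
  obtain ⟨a, ha, h, hd, hYY, -, hab, hne, h', hm, -, cov⟩ := hcov b hb
  have hcomp : deriv (f ∘ h) a = deriv f b * deriv h a := by
    rw [deriv_comp _ (by rw [hab]; exact hf.differentiableAt (hY₂.1.mem_nhds hb))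
      (hd.differentiableAt (hY₁.1.mem_nhds ha)), hab]
  refine sInf_le ⟨a, ha, f ∘ h, hf.comp hd hYY, hfΩ.comp hYY, by simp [hab, hfb],
    fun t ht hta ↦ hfne _ (hYY ht) (hne t ht hta), by rw [hcomp]; exact mul_ne_zero hf' h', ?_⟩
  congr 1
  unfold hurwitzDensity
  rw [hurwitzRadius_eq_norm_deriv_mul hY₁.1 ha hd hYY hab hne h' hm cov, hcomp, norm_mul,
    div_div, div_div]
  ring_nf
end
end
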